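/- arXiv:2106.00294 — 2 statements merged into one kernel-verified Lean document; each statement's English description precedes it below -/
import Mathlib

section
/- For m > 0 and ω > 0, ∫_0^∞ ρ J₀(ρ√(2ω)) / (ρ² + m²) dρ = K₀(√(2m²ω)), where J₀ is the Bessel function of the first kind of order 0 and K₀ is the modified Bessel function of the second kind of order 0. -/
open MeasureTheory

/-- Bessel function of the first kind of order 0, via its power series. -/
noncomputable def besselJ0 (x : ℝ) : ℝ :=
  ∑' k : ℕ, (-1) ^ k / (Nat.factorial k * Nat.factorial k) * (x / 2) ^ (2 * k)

/-- Modified Bessel function of the second kind of order 0, via its integral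
representation `K₀(x) = ∫_0^∞ e^{-x cosh t} dt`. -/
noncomputable def besselK0 (x : ℝ) : ℝ :=
  ∫ t in Set.Ioi (0 : ℝ), Real.exp (-x * Real.cosh t)

theorem summ_aux (c : ℕ → ℝ) (hc : ∀ k, |c k| ≤ 1 / (k.factorial : ℝ)) (y : ℝ) :
    Summable fun k => c k * y ^ k := by
  refine Summable.of_norm_bounded (Real.summable_pow_div_factorial |y|) fun k => ?_
  rw [norm_mul, norm_pow, Real.norm_eq_abs, Real.norm_eq_abs]
  calc _ ≤ 1 / (k.factorial : ℝ) * |y| ^ k := by gcongr; exact hc k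
    _ = _ := by ring

theorem deriv_aux (c : ℕ → ℝ) (hc : ∀ k, |c k| ≤ 1 / (k.factorial : ℝ)) (y : ℝ) :
    HasDerivAt (fun y => ∑' k : ℕ, c k * y ^ k) (∑' k : ℕ, ((k:ℝ) + 1) * c (k + 1) * y ^ k) y := by
  set R := |y| + 1
  have hs : Summable fun k : ℕ => (k:ℝ) * R ^ (k - 1) / k.factorial := by
    rw [← summable_nat_add_iff 1]
    refine (Real.summable_pow_div_factorial R).congr fun k => ?_
    rw [Nat.factorial_succ]
    push_cast
    have : (k.factorial : ℝ) ≠ 0 := by positivity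
    have : (k : ℝ) + 1 ≠ 0 := by positivity
    try simp only [Nat.add_sub_cancel]
    field_simp
  have key := hasDerivAt_tsum_of_isPreconnected (g := fun k y => c k * y ^ k)
    (g' := fun k y => c k * (k * y ^ (k - 1))) hs Metric.isOpen_ball
    (convex_ball (0:ℝ) R).isPreconnected
    (fun k z _ => (hasDerivAt_pow k z).const_mul (c k)) (fun k z hz => by
      have hz' : |z| ≤ R := by
        rw [mem_ball_zero_iff] at hz
        exact hz.le
      rw [norm_mul, norm_mul, norm_pow, Real.norm_eq_abs, Real.norm_eq_abs, Real.norm_eq_abs,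
        Nat.abs_cast]
      calc _ ≤ 1 / (k.factorial : ℝ) * (k * R ^ (k - 1)) := by gcongr; exact hc k
        _ = _ := by ring) (y₀ := 0) (by simp [R]; positivity) (summ_aux c hc 0) (y := y)
    (by simp [R])
  refine key.congr_deriv ?_
  have hs2 : Summable fun k : ℕ => c k * (k * y ^ (k - 1)) := by
    refine Summable.of_norm_bounded hs fun k => ?_
    rw [norm_mul, norm_mul, norm_pow, Real.norm_eq_abs, Real.norm_eq_abs, Real.norm_eq_abs,
        Nat.abs_cast]
    calc _ ≤ 1 / (k.factorial : ℝ) * (k * R ^ (k - 1)) := by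
          gcongr
          · exact hc k
          · simp [R]
      _ = _ := by ring
  rw [hs2.tsum_eq_zero_add]
  simp
  congr 1; ext k; ring

noncomputable def auxC (k : ℕ) : ℝ := (-1) ^ k / (Nat.factorial k * Nat.factorial k)
noncomputable def auxD (k : ℕ) : ℝ := - (k * auxC (k - 1)/ k^2)

theorem auxC_le (k : ℕ) : |auxC k| ≤ 1 / (k.factorial : ℝ) := by
  unfold auxC
  rw [abs_div, abs_pow, abs_neg, abs_one, one_pow, abs_of_pos (by positivity)]
  apply one_div_le_one_div_of_le (by positivity)
  have : (1:ℝ) ≤ k.factorial := by exact_mod_cast Nat.factorial_pos k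
  nlinarith

theorem auxD_succ (k : ℕ) : auxD (k+1) = - auxC k / (k + 1) := by
  unfold auxD
  have : (k : ℝ) + 1 ≠ 0 := by positivity
  push_cast
  try simp only [Nat.add_sub_cancel]
  field_simp

theorem auxD_le (k : ℕ) : |auxD k| ≤ 1 / (k.factorial : ℝ) := by
  cases k with
  | zero => simp [auxD]
  | succ k =>
    rw [auxD_succ, abs_div, abs_neg, abs_of_pos (by positivity : (0:ℝ) < k + 1), Nat.factorial_succ]
    push_cast
    calc _ ≤ 1 / (k.factorial : ℝ) / (k + 1) := by gcongr; exact auxC_le k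
      _ = _ := by field_simp

noncomputable def auxf (y : ℝ) : ℝ := ∑' k, auxC k * y ^ k
noncomputable def auxh (y : ℝ) : ℝ := ∑' k, auxD k * y ^ k

theorem auxh_deriv (y : ℝ) : HasDerivAt auxh (- auxf y) y := by
  refine (deriv_aux auxD auxD_le y).congr_deriv ?_
  symm
  unfold auxf
  rw [← tsum_neg]
  congr 1; ext k
  rw [auxD_succ]
  have : (k : ℝ) + 1 ≠ 0 := by positivity
  field_simp

theorem auxf_deriv (y : ℝ) (hy : y ≠ 0) : HasDerivAt auxf (auxh y / y) y := by
  refine (deriv_aux auxC auxC_le y).congr_deriv ?_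
  symm
  unfold auxh
  rw [(summ_aux auxD auxD_le y).tsum_eq_zero_add]
  have : auxD 0 = 0 := by simp [auxD]
  rw [this, zero_mul, zero_add, div_eq_iff hy, ← tsum_mul_right]
  congr 1; ext k
  rw [auxD_succ]
  unfold auxC
  rw [Nat.factorial_succ]
  have : (k.factorial : ℝ) ≠ 0 := by positivity
  have : (k : ℝ) + 1 ≠ 0 := by positivity
  push_cast
  field_simp
  ring

theorem auxf_cont : Continuous auxf :=
  continuous_iff_continuousAt.2 fun y => (deriv_aux auxC auxC_le y).continuousAt

theorem J0_eq (x : ℝ) : besselJ0 x = auxf (x ^ 2 / 4) := by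
  unfold besselJ0 auxf auxC
  congr 1; ext k
  rw [pow_mul]; congr 2; ring

theorem J0_cont : Continuous besselJ0 := by
  have : besselJ0 = fun x => auxf (x ^ 2 / 4) := funext J0_eq
  rw [this]
  exact auxf_cont.comp (by fun_prop)

theorem J0_deriv (x : ℝ) (hx : 0 < x) :
    HasDerivAt besselJ0 (2 * auxh (x ^ 2 / 4) / x) x := by
  have e : besselJ0 = fun x => auxf (x ^ 2 / 4) := funext J0_eq
  rw [e]
  have h2 : HasDerivAt (fun x : ℝ => x ^ 2 / 4) (x / 2) x := by
    refine ((hasDerivAt_pow 2 x).div_const 4).congr_deriv ?_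
    norm_num; ring
  refine ((auxf_deriv (x ^ 2 / 4) (by positivity)).comp x h2).congr_deriv ?_
  field_simp
  ring

theorem H_deriv (x : ℝ) :
    HasDerivAt (fun x => auxh (x ^ 2 / 4)) (- besselJ0 x * x / 2) x := by
  have h2 : HasDerivAt (fun x : ℝ => x ^ 2 / 4) (x / 2) x := by
    refine ((hasDerivAt_pow 2 x).div_const 4).congr_deriv ?_
    norm_num; ring
  refine ((auxh_deriv (x ^ 2 / 4)).comp x h2).congr_deriv ?_
  rw [J0_eq]; ring

noncomputable def auxE (x : ℝ) : ℝ := x * besselJ0 x ^ 2 + 4 * auxh (x ^ 2 / 4) ^ 2 / x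
  + 2 * besselJ0 x * auxh (x ^ 2 / 4) / x + besselJ0 x ^ 2 / (2 * x)

theorem auxE_deriv (x : ℝ) (hx : 0 < x) :
    HasDerivAt auxE (- besselJ0 x ^ 2 / (2 * x ^ 2)) x := by
  have hJ := J0_deriv x hx
  have hH := H_deriv x
  have hi := hasDerivAt_id x
  have hx0 : x ≠ 0 := hx.ne'
  refine ((((hi.mul (hJ.pow 2)).add (((hH.pow 2).const_mul 4).div hi hx0)).add
    (((hJ.const_mul 2).mul hH).div hi hx0)).add ((hJ.pow 2).div (hi.const_mul 2) (by simpa))).congr_deriv ?_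
  simp only [id, Pi.pow_apply, Pi.mul_apply]
  push_cast
  field_simp
  ring

theorem J0_bound : ∃ C, 0 ≤ C ∧ ∀ x : ℝ, 0 < x → |besselJ0 x| ≤ C * x ^ (-(1/2) : ℝ) := by
  obtain ⟨M, hM⟩ := (isCompact_Icc (a := (0:ℝ)) (b := 1)).exists_bound_of_continuousOn
    J0_cont.continuousOn
  have hM0 : 0 ≤ M := (norm_nonneg _).trans (hM 0 (by simp))
  refine ⟨max M √(auxE 1), le_max_of_le_left hM0, fun x hx => ?_⟩
  have hp : 0 < x ^ (-(1/2) : ℝ) := Real.rpow_pos_of_pos hx _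
  rcases le_total x 1 with h1 | h1
  · have : 1 ≤ x ^ (-(1/2) : ℝ) := Real.one_le_rpow_of_pos_of_le_one_of_nonpos hx h1 (by norm_num)
    have h2 := hM x ⟨hx.le, h1⟩
    rw [Real.norm_eq_abs] at h2
    calc |besselJ0 x| ≤ M * 1 := by simpa
      _ ≤ _ := by gcongr; exact le_max_left _ _
  · have anti : AntitoneOn auxE (Set.Ici 1) := by
      apply antitoneOn_of_deriv_nonpos (convex_Ici 1)
      · exact fun y hy => (auxE_deriv y (by simp at hy; linarith)).continuousAt.continuousWithinAt
      · intro y hy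
        rw [interior_Ici] at hy
        exact (auxE_deriv y (by simp at hy; linarith)).differentiableAt.differentiableWithinAt
      · intro y hy
        rw [interior_Ici] at hy
        rw [(auxE_deriv y (by simp at hy; linarith)).deriv, neg_div]
        have : 0 ≤ besselJ0 y ^ 2 / (2 * y ^ 2) := by positivity
        linarith
    have hE := anti (Set.mem_Ici.2 le_rfl) (Set.mem_Ici.2 h1) h1
    have hE2 : x * besselJ0 x ^ 2 ≤ auxE x := by
      have : auxE x - x * besselJ0 x ^ 2
        = (2 * auxh (x^2/4) + besselJ0 x / 2) ^ 2 / x + besselJ0 x ^ 2 / (4 * x) := by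
        unfold auxE
        field_simp
        ring
      have h3 : 0 ≤ (2 * auxh (x^2/4) + besselJ0 x / 2) ^ 2 / x + besselJ0 x ^ 2 / (4 * x) := by
        positivity
      linarith
    have : |besselJ0 x| ≤ √(auxE 1) * x ^ (-(1/2) : ℝ) := by
      rw [Real.rpow_neg hx.le, ← Real.sqrt_eq_rpow, ← div_eq_mul_inv, ← Real.sqrt_div' _ hx.le]
      apply Real.abs_le_sqrt
      rw [le_div_iff₀ hx]
      linarith
    exact this.trans (by gcongr; exact le_max_right _ _)

theorem main_integrable (m a : ℝ) (hm : 0 < m) (ha : 0 < a) :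
    IntegrableOn (fun ρ => ρ * besselJ0 (ρ * a) / (ρ ^ 2 + m ^ 2)) (Set.Ioi 0) := by
  have hc : Continuous (fun ρ => ρ * besselJ0 (ρ * a) / (ρ ^ 2 + m ^ 2)) := by
    refine Continuous.div ?_ (by fun_prop) (fun x => by positivity)
    exact continuous_id.mul (J0_cont.comp (by fun_prop))
  rw [← Set.Ioc_union_Ioi_eq_Ioi zero_le_one]
  refine IntegrableOn.union ((hc.integrableOn_Icc (a := 0) (b := 1)).mono_set Set.Ioc_subset_Icc_self) ?_
  obtain ⟨C, hC0, hC⟩ := J0_bound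
  have hi := (integrableOn_Ioi_rpow_of_lt (a := -(3/2)) (by norm_num) zero_lt_one).const_mul
    (C * a ^ (-(1/2) : ℝ))
  refine Integrable.mono' hi hc.aestronglyMeasurable ?_
  refine (ae_restrict_iff' measurableSet_Ioi).2 (Filter.Eventually.of_forall fun ρ hρ => ?_)
  have hρ1 : (1:ℝ) < ρ := hρ
  have h0 : 0 < ρ := by linarith
  have hb := hC (ρ * a) (by positivity)
  rw [Real.mul_rpow h0.le ha.le] at hb
  rw [norm_div, norm_mul, Real.norm_eq_abs, Real.norm_eq_abs, Real.norm_eq_abs, abs_of_pos h0,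
    abs_of_pos (by positivity : 0 < ρ ^ 2 + m ^ 2)]
  have h2 : ρ ^ (-(3/2) : ℝ) = ρ ^ (-(1/2) : ℝ) / ρ := by
    rw [show (-(3/2) : ℝ) = -(1/2) - 1 by norm_num, Real.rpow_sub_one h0.ne']
  have hA : 0 < ρ ^ (-(1/2) : ℝ) := Real.rpow_pos_of_pos h0 _
  have hB : 0 < a ^ (-(1/2) : ℝ) := Real.rpow_pos_of_pos ha _
  rw [h2]
  calc _ ≤ ρ * (C * (ρ ^ (-(1/2) : ℝ) * a ^ (-(1/2) : ℝ))) / ρ ^ 2 := by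
        gcongr
        nlinarith [sq_nonneg m]
    _ = _ := by field_simp

theorem moment (s : ℝ) (hs : 0 < s) (k : ℕ) :
    IntegrableOn (fun x : ℝ => x ^ (2 * k + 1) * Real.exp (-s * x ^ 2)) (Set.Ioi 0) ∧
    ∫ x in Set.Ioi (0:ℝ), x ^ (2 * k + 1) * Real.exp (-s * x ^ 2) =
      k.factorial / (2 * s ^ (k + 1)) := by
  have e : ∀ x : ℝ, x ^ (2 * k + 1) * Real.exp (-s * x ^ 2)
      = x ^ ((2 * k + 1 : ℕ) : ℝ) * Real.exp (-s * x ^ (2:ℝ)) := by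
    intro x
    rw [Real.rpow_natCast, show (2:ℝ) = ((2:ℕ):ℝ) by norm_num, Real.rpow_natCast]
  have hk : (-1:ℝ) < ((2 * k + 1 : ℕ) : ℝ) := by
    have : (0:ℝ) ≤ ((2 * k + 1 : ℕ) : ℝ) := by positivity
    linarith
  simp_rw [e]
  refine ⟨integrableOn_rpow_mul_exp_neg_mul_rpow hk two_pos hs, ?_⟩
  rw [integral_rpow_mul_exp_neg_mul_rpow two_pos hk hs]
  have h1 : (((2 * k + 1 : ℕ) : ℝ) + 1) / 2 = k + 1 := by push_cast; ring
  rw [neg_div, h1, Real.Gamma_nat_eq_factorial, Real.rpow_neg hs.le,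
    show (k:ℝ) + 1 = ((k + 1 : ℕ) : ℝ) by push_cast; ring, Real.rpow_natCast]
  field_simp

theorem gauss (a s : ℝ) (hs : 0 < s) :
    ∫ x in Set.Ioi (0:ℝ), x * besselJ0 (x * a) * Real.exp (-s * x ^ 2)
      = Real.exp (-(a ^ 2 / (4 * s))) / (2 * s) := by
  set F : ℕ → ℝ → ℝ := fun k x => ((-1) ^ k / (Nat.factorial k * Nat.factorial k) * (a / 2) ^ (2 * k))
    * (x ^ (2 * k + 1) * Real.exp (-s * x ^ 2)) with hF
  have hv : ∀ k : ℕ, ∀ ε : ℝ, (ε / (Nat.factorial k * Nat.factorial k) * (a / 2) ^ (2 * k)) *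
      (k.factorial / (2 * s ^ (k + 1))) = ε * (a ^ 2 / (4 * s)) ^ k / k.factorial / (2 * s) := by
    intro k ε
    have : (k.factorial : ℝ) ≠ 0 := by positivity
    rw [pow_mul, div_pow a 2, div_pow, div_pow, mul_pow]
    norm_num
    field_simp
    ring
  have hint : ∀ k, Integrable (F k) (volume.restrict (Set.Ioi 0)) := fun k =>
    (moment s hs k).1.const_mul _
  have hsum : Summable fun k => ∫ x in Set.Ioi (0:ℝ), ‖F k x‖ := by
    refine ((Real.summable_pow_div_factorial (a ^ 2 / (4 * s))).div_const (2 * s)).congr fun k => ?_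
    have : ∫ x in Set.Ioi (0:ℝ), ‖F k x‖ = ∫ x in Set.Ioi (0:ℝ),
        (1 / (Nat.factorial k * Nat.factorial k) * (a / 2) ^ (2 * k))
        * (x ^ (2 * k + 1) * Real.exp (-s * x ^ 2)) := by
      refine setIntegral_congr_fun measurableSet_Ioi fun x hx => ?_
      have hx : 0 < x := hx
      have h1 : 0 ≤ (a / 2) ^ (2 * k) := by rw [pow_mul]; positivity
      have h2 : 0 ≤ x ^ (2 * k + 1) * Real.exp (-s * x ^ 2) := by positivity
      simp only [hF]
      rw [norm_mul, norm_mul, norm_div, norm_pow, norm_neg, norm_one, one_pow,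
        Real.norm_of_nonneg h1, Real.norm_of_nonneg h2, Real.norm_of_nonneg (by positivity)]
    rw [this, integral_const_mul, (moment s hs k).2, hv, one_mul]
  have H := hasSum_integral_of_summable_integral_norm hint hsum
  have hrhs : ∫ x in Set.Ioi (0:ℝ), x * besselJ0 (x * a) * Real.exp (-s * x ^ 2)
      = ∫ x in Set.Ioi (0:ℝ), ∑' k, F k x := by
    refine setIntegral_congr_fun measurableSet_Ioi fun x hx => ?_
    simp only [besselJ0, hF]
    rw [← tsum_mul_left, ← tsum_mul_right]
    congr 1; ext k
    rw [show x * a / 2 = x * (a / 2) by ring, mul_pow]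
    ring
  rw [hrhs, ← H.tsum_eq]
  have : ∀ k, ∫ x in Set.Ioi (0:ℝ), F k x = (-(a ^ 2 / (4 * s))) ^ k / k.factorial / (2 * s) := by
    intro k
    simp only [hF]
    rw [integral_const_mul, (moment s hs k).2, hv, neg_pow (a ^ 2 / (4 * s))]
  simp_rw [this]
  rw [tsum_div_const, Real.exp_eq_exp_ℝ, NormedSpace.exp_eq_tsum_div]

theorem K0_subst (m a : ℝ) (hm : 0 < m) (ha : 0 < a) :
    ∫ s in Set.Ioi (0:ℝ), Real.exp (-s * m ^ 2) * (Real.exp (-(a ^ 2 / (4 * s))) / (2 * s))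
      = besselK0 (a * m) := by
  have himg : (fun t : ℝ => a / (2 * m) * Real.exp t) '' Set.univ = Set.Ioi 0 := by
    ext y
    simp only [Set.image_univ, Set.mem_range, Set.mem_Ioi]
    constructor
    · rintro ⟨t, rfl⟩; positivity
    · intro hy
      refine ⟨Real.log (y / (a / (2 * m))), ?_⟩
      rw [Real.exp_log (by positivity)]
      field_simp
  rw [← himg, integral_image_eq_integral_abs_deriv_smul MeasurableSet.univ
    (fun t _ => ((Real.hasDerivAt_exp t).const_mul (a / (2 * m))).hasDerivWithinAt)
    (fun x _ y _ h => by
      have : a / (2 * m) ≠ 0 := by positivity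
      exact Real.exp_injective (mul_left_cancel₀ this h))]
  rw [setIntegral_univ]
  have : ∀ t : ℝ, |a / (2 * m) * Real.exp t| • (Real.exp (-(a / (2 * m) * Real.exp t) * m ^ 2) *
      (Real.exp (-(a ^ 2 / (4 * (a / (2 * m) * Real.exp t)))) / (2 * (a / (2 * m) * Real.exp t))))
      = (1 / 2) * Real.exp (-(a * m) * Real.cosh |t|) := by
    intro t
    have he := Real.exp_pos t
    rw [Real.cosh_abs, abs_of_pos (by positivity), smul_eq_mul, mul_div_assoc', ← Real.exp_add]
    have : -(a / (2 * m) * Real.exp t) * m ^ 2 + -(a ^ 2 / (4 * (a / (2 * m) * Real.exp t)))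
        = -(a * m) * Real.cosh t := by
      rw [Real.cosh_eq, Real.exp_neg]
      field_simp
      ring
    rw [this]
    field_simp
  simp_rw [this]
  rw [integral_const_mul, integral_comp_abs (f := fun t => Real.exp (-(a * m) * Real.cosh t))]
  unfold besselK0
  ring

/-- For `m, ω > 0`: `∫_0^∞ ρ J₀(ρ√(2ω))/(ρ²+m²) dρ = K₀(√(2m²ω))`. -/
theorem integral_besselJ0_eq_besselK0 (m ω : ℝ) (hm : 0 < m) (hω : 0 < ω) :
    ∫ ρ in Set.Ioi (0 : ℝ), ρ * besselJ0 (ρ * Real.sqrt (2 * ω)) / (ρ ^ 2 + m ^ 2)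
      = besselK0 (Real.sqrt (2 * m ^ 2 * ω)) := by
  have ha : 0 < Real.sqrt (2 * ω) := Real.sqrt_pos.2 (by positivity)
  have hr : Real.sqrt (2 * m ^ 2 * ω) = Real.sqrt (2 * ω) * m := by
    rw [show 2 * m ^ 2 * ω = 2 * ω * m ^ 2 by ring, Real.sqrt_mul (by positivity),
      Real.sqrt_sq hm.le]
  rw [hr]
  set a := Real.sqrt (2 * ω)
  rw [← K0_subst m a hm ha]
  have hlap : ∀ ρ : ℝ, ∀ c : ℝ, ∫ s in Set.Ioi (0:ℝ), c * Real.exp (-(ρ ^ 2 + m ^ 2) * s)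
      = c / (ρ ^ 2 + m ^ 2) := by
    intro ρ c
    have h : 0 < ρ ^ 2 + m ^ 2 := by positivity
    rw [integral_const_mul, integral_exp_mul_Ioi (by linarith)]
    rw [mul_zero, Real.exp_zero, neg_div_neg_eq, mul_one_div]
  have hswap : ∫ ρ in Set.Ioi (0:ℝ), ∫ s in Set.Ioi (0:ℝ),
      (ρ * besselJ0 (ρ * a)) * Real.exp (-(ρ ^ 2 + m ^ 2) * s) =
      ∫ s in Set.Ioi (0:ℝ), ∫ ρ in Set.Ioi (0:ℝ),
      (ρ * besselJ0 (ρ * a)) * Real.exp (-(ρ ^ 2 + m ^ 2) * s) := by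
    apply integral_integral_swap
    have hc : Continuous (Function.uncurry fun ρ s : ℝ =>
        (ρ * besselJ0 (ρ * a)) * Real.exp (-(ρ ^ 2 + m ^ 2) * s)) := by
      unfold Function.uncurry
      have : Continuous fun p : ℝ × ℝ => besselJ0 (p.1 * a) := J0_cont.comp (by fun_prop)
      fun_prop
    rw [integrable_prod_iff hc.aestronglyMeasurable]
    constructor
    · refine Filter.Eventually.of_forall fun ρ => ?_
      have h : 0 < ρ ^ 2 + m ^ 2 := by positivity
      exact (integrableOn_exp_mul_Ioi (neg_neg_of_pos h) 0).const_mul (ρ * besselJ0 (ρ * a))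
    · refine (main_integrable m a hm ha).norm.congr (Filter.Eventually.of_forall fun ρ => ?_)
      have h : 0 < ρ ^ 2 + m ^ 2 := by positivity
      simp only [Function.uncurry, norm_mul, Real.norm_of_nonneg (Real.exp_pos _).le]
      rw [hlap, norm_div, norm_mul, Real.norm_of_nonneg h.le]
  simp_rw [hlap] at hswap
  rw [hswap]
  refine setIntegral_congr_fun measurableSet_Ioi fun s hs => ?_
  have hs : 0 < s := hs
  rw [← gauss a s hs, ← integral_const_mul]
  congr 1; ext ρ
  rw [show -(ρ ^ 2 + m ^ 2) * s = -s * m ^ 2 + -s * ρ ^ 2 by ring, Real.exp_add]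
  ring
end

section
/- For ω > 0, the integral 2∫_0^∞ ρ J₀(ρ√(2ω)) (e^{-s/ρ²} − 1) dρ, understood as an improper (conditionally convergent) integral, equals ∑_{k=1}^∞ s^k [ln s − 2H_{k-1} − H_k + ln ω + 3γ − ln 2] / ((k-1)!² k!) (ω/2)^{k-1} for all s ≥ 0. -/
open Filter

/-- The j-th harmonic number, `H_0 = 0`. -/
noncomputable def harmonicNumber (j : ℕ) : ℝ :=
  ∑ i ∈ Finset.range j, (1 : ℝ) / (i + 1)

section Helpers
open MeasureTheory Set Topology

/-- `E m u = ∑ (-u)^k / (k! (k+m)!)`. -/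
noncomputable def EE (m : ℕ) (u : ℝ) : ℝ :=
  ∑' k : ℕ, (-u) ^ k / (Nat.factorial k * Nat.factorial (k + m))

lemma EE_norm_term (m k : ℕ) (u : ℝ) :
    ‖(-u) ^ k / ((Nat.factorial k : ℝ) * Nat.factorial (k + m))‖ ≤ |u| ^ k / Nat.factorial k := by
  rw [norm_div, norm_pow, norm_neg, Real.norm_eq_abs, Real.norm_eq_abs,
    abs_of_nonneg (by positivity : (0 : ℝ) ≤ (Nat.factorial k : ℝ) * Nat.factorial (k + m))]
  apply div_le_div_of_nonneg_left (by positivity) (by positivity)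
  have : (1 : ℝ) ≤ Nat.factorial (k + m) := by exact_mod_cast Nat.factorial_pos _
  nlinarith [(by positivity : (0 : ℝ) < Nat.factorial k)]

lemma EE_summable (m : ℕ) (u : ℝ) :
    Summable (fun k : ℕ => (-u) ^ k / ((Nat.factorial k : ℝ) * Nat.factorial (k + m))) :=
  Summable.of_norm_bounded (Real.summable_pow_div_factorial |u|) (EE_norm_term m · u)

lemma EE_hasDerivAt (m : ℕ) (u : ℝ) : HasDerivAt (EE m) (-EE (m + 1) u) u := by
  set r : ℝ := |u| + 1
  have hsum : Summable (fun n : ℕ => (n : ℝ) * r ^ (n - 1) / Nat.factorial n) := by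
    rw [← summable_nat_add_iff 1]
    refine (Real.summable_pow_div_factorial r).congr fun k => ?_
    rw [Nat.factorial_succ]; push_cast
    field_simp
  have hd : ∀ (n : ℕ) (y : ℝ), y ∈ Metric.ball (0 : ℝ) r →
      HasDerivAt (fun y : ℝ => (-y) ^ n / ((Nat.factorial n : ℝ) * Nat.factorial (n + m)))
        (((n : ℝ) * (-y) ^ (n - 1) * (-1)) / ((Nat.factorial n : ℝ) * Nat.factorial (n + m))) y := by
    intro n y _
    exact (((hasDerivAt_id y).neg).pow n).div_const _
  have hb : ∀ (n : ℕ) (y : ℝ), y ∈ Metric.ball (0 : ℝ) r →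
      ‖((n : ℝ) * (-y) ^ (n - 1) * (-1)) / ((Nat.factorial n : ℝ) * Nat.factorial (n + m))‖
        ≤ (n : ℝ) * r ^ (n - 1) / Nat.factorial n := by
    intro n y hy
    have hy' : |y| ≤ r := by simpa using (mem_ball_zero_iff.mp hy).le
    have h1 : (1 : ℝ) ≤ Nat.factorial (n + m) := by exact_mod_cast Nat.factorial_pos _
    have h2 : (0 : ℝ) < Nat.factorial n := by positivity
    rw [norm_div, norm_mul, norm_mul, norm_pow, norm_neg, norm_neg, norm_one, mul_one]
    simp only [Real.norm_eq_abs]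
    rw [abs_of_nonneg (by positivity : (0 : ℝ) ≤ (Nat.factorial n : ℝ) * Nat.factorial (n + m)),
      abs_of_nonneg (by positivity : (0 : ℝ) ≤ (n : ℝ))]
    apply div_le_div₀ (by positivity) _ h2 (by nlinarith)
    gcongr
  have h := hasDerivAt_tsum_of_isPreconnected hsum Metric.isOpen_ball
    (convex_ball (0 : ℝ) r).isPreconnected hd hb (y₀ := 0) (y := u)
    (Metric.mem_ball_self (by positivity)) (EE_summable m 0)
    (by simp [r])
  refine h.congr_deriv ?_
  have hs' : Summable (fun n : ℕ => ((n : ℝ) * (-u) ^ (n - 1) * (-1)) /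
      ((Nat.factorial n : ℝ) * Nat.factorial (n + m))) :=
    Summable.of_norm_bounded hsum (fun n => hb n u (by simp [r]))
  rw [hs'.tsum_eq_zero_add, EE, ← tsum_neg]
  simp only [Nat.cast_zero, zero_mul, zero_div, zero_add]
  congr 1; ext k
  rw [Nat.factorial_succ k, show k + 1 + m = k + (m + 1) by ring]
  simp only [Nat.add_sub_cancel]
  push_cast
  field_simp

lemma EE_rec (m : ℕ) (u : ℝ) : u * EE (m + 2) u = (m + 1) * EE (m + 1) u - EE m u := by
  have h := (EE_summable (m + 1) u).mul_left ((m : ℝ) + 1) |>.sub (EE_summable m u)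
  rw [EE, EE, EE, ← tsum_mul_left, ← tsum_mul_left, ← ((EE_summable (m + 1) u).mul_left ((m : ℝ) + 1)).tsum_sub (EE_summable m u),
    h.tsum_eq_zero_add]
  have h0 : ((m : ℝ) + 1) * ((-u) ^ 0 / ((Nat.factorial 0 : ℝ) * Nat.factorial (0 + (m + 1)))) -
      (-u) ^ 0 / ((Nat.factorial 0 : ℝ) * Nat.factorial (0 + m)) = 0 := by
    simp only [zero_add, Nat.factorial_succ, pow_zero]
    push_cast; field_simp; ring
  rw [h0, zero_add]
  congr 1; ext k
  rw [show k + 1 + (m + 1) = (k + m + 1) + 1 by ring, show k + (m + 2) = (k + m + 1) + 1 by ring, show k + 1 + m = k + m + 1 by ring,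
    Nat.factorial_succ (k + m + 1), Nat.factorial_succ (k + m), Nat.factorial_succ k]
  push_cast
  field_simp
  ring

lemma EE_zero (m : ℕ) : EE m 0 = 1 / Nat.factorial m := by
  rw [EE, tsum_eq_single 0]
  · simp
  · intro k hk; simp [hk]

lemma EE_energy (m : ℕ) (u : ℝ) (hu : 0 ≤ u) : EE m u ^ 2 + u * EE (m + 1) u ^ 2 ≤ 1 := by
  have hd : ∀ x : ℝ, HasDerivAt (fun x => EE m x ^ 2 + x * EE (m + 1) x ^ 2)
      (-(2 * m + 1) * EE (m + 1) x ^ 2) x := by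
    intro x
    have h := ((EE_hasDerivAt m x).pow 2).add ((hasDerivAt_id x).mul ((EE_hasDerivAt (m + 1) x).pow 2))
    refine h.congr_deriv ?_
    have := EE_rec m x
    simp
    linear_combination (-2) * EE (m + 1) x * this
  have ha : AntitoneOn (fun x => EE m x ^ 2 + x * EE (m + 1) x ^ 2) (Ici 0) := by
    apply antitoneOn_of_deriv_nonpos (convex_Ici 0)
    · exact fun x _ => (hd x).continuousAt.continuousWithinAt
    · exact fun x _ => (hd x).differentiableAt.differentiableWithinAt
    · intro x _
      rw [(hd x).deriv]
      have : (0 : ℝ) ≤ (2 * m + 1) * EE (m + 1) x ^ 2 := by positivity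
      linarith
  have h := ha (by simp : (0 : ℝ) ∈ Ici 0) (by simpa using hu) hu
  simp only [EE_zero, zero_mul, add_zero] at h
  refine h.trans ?_
  have : (1 : ℝ) ≤ Nat.factorial m := by exact_mod_cast Nat.factorial_pos _
  rw [div_pow, one_pow, div_le_one (by positivity)]
  nlinarith

lemma EE_abs_le (m : ℕ) (u : ℝ) (hu : 0 ≤ u) : |EE m u| ≤ 1 := by
  have := EE_energy m u hu
  rw [← sq_le_one_iff_abs_le_one]
  nlinarith [mul_nonneg hu (sq_nonneg (EE (m + 1) u))]

lemma EE_abs_le_sqrt (u : ℝ) (hu : 0 ≤ u) : |u * EE 1 u| ≤ Real.sqrt u := by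
  have := EE_energy 0 u hu
  apply Real.abs_le_sqrt
  nlinarith [sq_nonneg (EE 0 u)]

lemma EE_continuous (m : ℕ) : Continuous (EE m) :=
  continuous_iff_continuousAt.mpr fun x => (EE_hasDerivAt m x).continuousAt

lemma EE_one_sub (u : ℝ) (hu : 0 ≤ u) : |1 - EE 1 u| ≤ u := by
  have h := (convex_Ici (0 : ℝ)).norm_image_sub_le_of_norm_hasDerivWithin_le (f := EE 1)
    (f' := fun x => -EE 2 x) (C := 1) (x := u) (y := 0)
    (fun x _ => (EE_hasDerivAt 1 x).hasDerivWithinAt)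
    (fun x hx => by rw [norm_neg]; exact EE_abs_le 2 x hx) hu (by simp)
  simpa [EE_zero, abs_of_nonneg hu] using h

lemma besselJ0_eq (ω ρ : ℝ) (hω : 0 < ω) : besselJ0 (ρ * Real.sqrt (2 * ω)) = EE 0 (ω * ρ ^ 2 / 2) := by
  rw [besselJ0, EE]
  congr 1; ext k
  have : (ρ * Real.sqrt (2 * ω) / 2) ^ 2 = ω * ρ ^ 2 / 2 := by
    rw [div_pow, mul_pow, Real.sq_sqrt (by positivity)]; ring
  rw [pow_mul, this, neg_pow (ω * ρ ^ 2 / 2)]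
  simp; ring

/-- The basic integrals. -/
noncomputable def II (φ : ℝ → ℝ) (n : ℕ) (c : ℝ) : ℝ :=
  ∫ u in Ioi (0 : ℝ), φ u * (u⁻¹) ^ n * Real.exp (-(c / u))

lemma pow_exp_bound (n : ℕ) (c u : ℝ) (hc : 0 < c) (hu : 0 < u) :
    (u⁻¹) ^ n * Real.exp (-(c / u)) ≤ Nat.factorial n / c ^ n := by
  have h := Real.pow_div_factorial_le_exp (c / u) (by positivity) n
  rw [Real.exp_neg, ← div_eq_mul_inv, div_le_div_iff₀ (Real.exp_pos _) (by positivity)]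
  rw [div_le_iff₀ (by positivity)] at h
  calc (u⁻¹) ^ n * c ^ n = (c / u) ^ n := by rw [← mul_pow, div_eq_mul_inv, mul_comm]
    _ ≤ _ := by linarith

lemma contOn_aux (φ : ℝ → ℝ) (hφ : Continuous φ) (n : ℕ) (c : ℝ) :
    ContinuousOn (fun u : ℝ => φ u * (u⁻¹) ^ n * Real.exp (-(c / u))) (Ioi 0) := by
  have h : ∀ u ∈ Ioi (0 : ℝ), u ≠ 0 := fun u hu => (ne_of_gt hu)
  refine ((hφ.continuousOn).mul ((continuousOn_inv₀.mono h).pow n)).mul ?_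
  exact Real.continuous_exp.comp_continuousOn ((continuousOn_const.div continuousOn_id h).neg)

lemma bnd_integrable (n : ℕ) (hn : 2 ≤ n) (c : ℝ) (hc : 0 < c) :
    IntegrableOn (fun u : ℝ => (1 + Real.sqrt u) * (u⁻¹) ^ n * Real.exp (-(c / u))) (Ioi 0) := by
  have hcont := contOn_aux (fun u => 1 + Real.sqrt u) (by fun_prop) n c
  rw [← Ioc_union_Ioi_eq_Ioi (zero_le_one : (0 : ℝ) ≤ 1)]
  apply IntegrableOn.union
  · have hi : IntegrableOn (fun _ : ℝ => 2 * (Nat.factorial n / c ^ n)) (Ioc 0 1) :=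
      integrableOn_const (by simp)
    refine Integrable.mono' hi ?_ ?_
    · exact (hcont.mono Ioc_subset_Ioi_self).aestronglyMeasurable measurableSet_Ioc
    · refine (ae_restrict_iff' measurableSet_Ioc).mpr (ae_of_all _ fun u hu => ?_)
      have hu0 : 0 < u := hu.1
      have h1 : Real.sqrt u ≤ 1 := Real.sqrt_le_one.mpr hu.2
      rw [Real.norm_eq_abs, abs_of_nonneg (by positivity), mul_assoc]
      exact mul_le_mul (by linarith) (pow_exp_bound n c u hc hu0) (by positivity) (by norm_num)
  · have hi : IntegrableOn (fun u : ℝ => 2 * u ^ (-(3 / 2) : ℝ)) (Ioi 1) :=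
      (integrableOn_Ioi_rpow_of_lt (by norm_num) one_pos).const_mul 2
    refine Integrable.mono' hi ?_ ?_
    · exact (hcont.mono (Ioi_subset_Ioi zero_le_one)).aestronglyMeasurable measurableSet_Ioi
    · refine (ae_restrict_iff' measurableSet_Ioi).mpr (ae_of_all _ fun u (hu : 1 < u) => ?_)
      have hu0 : 0 < u := by linarith
      rw [Real.norm_eq_abs, abs_of_nonneg (by positivity)]
      have h1 : 1 ≤ Real.sqrt u := Real.one_le_sqrt.mpr hu.le
      have h2 : (u⁻¹) ^ n ≤ (u⁻¹) ^ 2 := pow_le_pow_of_le_one (by positivity) (inv_le_one_of_one_le₀ hu.le) hn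
      have h3 : Real.exp (-(c / u)) ≤ 1 := Real.exp_le_one_iff.mpr (by
        have : 0 < c / u := by positivity
        linarith)
      have h4 : u ^ (-(3 / 2) : ℝ) = Real.sqrt u * (u⁻¹) ^ 2 := by
        rw [Real.sqrt_eq_rpow, ← Real.rpow_natCast (u⁻¹) 2, Real.inv_rpow hu0.le, ← Real.rpow_neg hu0.le,
          ← Real.rpow_add hu0]
        norm_num
      rw [h4]
      calc (1 + Real.sqrt u) * u⁻¹ ^ n * Real.exp (-(c / u))
          ≤ (2 * Real.sqrt u) * u⁻¹ ^ 2 * 1 := by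
            apply mul_le_mul _ h3 (by positivity) (by positivity)
            exact mul_le_mul (by linarith) h2 (by positivity) (by positivity)
        _ = _ := by ring

/-- Admissible functions. -/
def Adm (φ : ℝ → ℝ) : Prop := Continuous φ ∧ ∀ u, 0 < u → |φ u| ≤ 1 + Real.sqrt u

lemma II_norm_le {φ : ℝ → ℝ} (hφ : Adm φ) (n : ℕ) (c u : ℝ) (hu : 0 < u) :
    ‖φ u * (u⁻¹) ^ n * Real.exp (-(c / u))‖ ≤ (1 + Real.sqrt u) * (u⁻¹) ^ n * Real.exp (-(c / u)) := by
  rw [norm_mul, norm_mul, Real.norm_eq_abs, Real.norm_eq_abs, Real.norm_eq_abs, Real.abs_exp,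
    abs_of_nonneg (by positivity : 0 ≤ (u⁻¹) ^ n)]
  have := hφ.2 u hu
  gcongr

lemma II_integrable {φ : ℝ → ℝ} (hφ : Adm φ) (n : ℕ) (hn : 2 ≤ n) (c : ℝ) (hc : 0 < c) :
    IntegrableOn (fun u : ℝ => φ u * (u⁻¹) ^ n * Real.exp (-(c / u))) (Ioi 0) := by
  refine Integrable.mono' (bnd_integrable n hn c hc)
    ((contOn_aux φ hφ.1 n c).aestronglyMeasurable measurableSet_Ioi) ?_
  exact (ae_restrict_iff' measurableSet_Ioi).mpr (ae_of_all _ fun u hu => II_norm_le hφ n c u hu)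

lemma II_hasDerivAt {φ : ℝ → ℝ} (hφ : Adm φ) (n : ℕ) (hn : 2 ≤ n) (c : ℝ) (hc : 0 < c) :
    HasDerivAt (II φ n) (-II φ (n + 1) c) c := by
  have h := hasDerivAt_integral_of_dominated_loc_of_deriv_le (μ := volume.restrict (Ioi (0 : ℝ)))
    (F := fun c u => φ u * (u⁻¹) ^ n * Real.exp (-(c / u)))
    (F' := fun c u => -(φ u * (u⁻¹) ^ (n + 1) * Real.exp (-(c / u)))) (x₀ := c)
    (s := Ioi (c / 2))
    (bound := fun u => (1 + Real.sqrt u) * (u⁻¹) ^ (n + 1) * Real.exp (-(c / 2 / u)))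
    (Ioi_mem_nhds (by linarith))
    (Eventually.of_forall fun x => (contOn_aux φ hφ.1 n x).aestronglyMeasurable measurableSet_Ioi)
    (II_integrable hφ n hn c hc)
    ((contOn_aux φ hφ.1 (n + 1) c).neg.aestronglyMeasurable measurableSet_Ioi)
    ?_ (bnd_integrable (n + 1) (by omega) (c / 2) (by positivity)) ?_
  · have h2 := h.2
    rw [integral_neg] at h2
    exact h2
  · refine (ae_restrict_iff' measurableSet_Ioi).mpr (ae_of_all _ fun u (hu : 0 < u) x (hx : c / 2 < x) => ?_)
    rw [norm_neg]
    refine (II_norm_le hφ (n + 1) x u hu).trans ?_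
    gcongr
  · refine (ae_restrict_iff' measurableSet_Ioi).mpr (ae_of_all _ fun u (hu : 0 < u) x _ => ?_)
    have h1 : HasDerivAt (fun x : ℝ => Real.exp (-(x / u))) (Real.exp (-(x / u)) * (-(1 / u))) x :=
      (((hasDerivAt_id x).div_const u).neg).exp
    refine (h1.const_mul (φ u * (u⁻¹) ^ n)).congr_deriv ?_
    rw [pow_succ]; ring

lemma II_parts {φ φ' : ℝ → ℝ} (hφ : Adm φ) (hd : ∀ u, 0 < u → HasDerivAt φ (φ' u) u)
    (m : ℕ) (hm : 1 ≤ m) (c : ℝ) (hc : 0 < c)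
    (hi : IntegrableOn (fun u : ℝ => φ' u * (u⁻¹) ^ m * Real.exp (-(c / u))) (Ioi 0)) :
    II φ' m c - m * II φ (m + 1) c + c * II φ (m + 2) c = 0 := by
  have hi1 := II_integrable hφ (m + 1) (by omega) c hc
  have hi2 := II_integrable hφ (m + 2) (by omega) c hc
  have key := integral_Ioi_of_hasDerivAt_of_tendsto (a := (0 : ℝ)) (m := (0 : ℝ))
    (f := fun u : ℝ => φ u * (u⁻¹) ^ m * Real.exp (-(c / u)))
    (f' := fun u => φ' u * (u⁻¹) ^ m * Real.exp (-(c / u))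
      - m * (φ u * (u⁻¹) ^ (m + 1) * Real.exp (-(c / u)))
      + c * (φ u * (u⁻¹) ^ (m + 2) * Real.exp (-(c / u)))) ?_ ?_ ?_ ?_
  · have e : ∫ u in Ioi (0 : ℝ), (φ' u * (u⁻¹) ^ m * Real.exp (-(c / u))
      - m * (φ u * (u⁻¹) ^ (m + 1) * Real.exp (-(c / u)))
      + c * (φ u * (u⁻¹) ^ (m + 2) * Real.exp (-(c / u)))) =
      II φ' m c - m * II φ (m + 1) c + c * II φ (m + 2) c := by
      rw [integral_add (by exact hi.sub (hi1.const_mul _)) (hi2.const_mul _),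
        integral_sub hi (hi1.const_mul _), integral_const_mul, integral_const_mul]
      rfl
    rw [e] at key
    rw [key]
    simp [show m ≠ 0 by omega]
  · rw [ContinuousWithinAt, inv_zero, zero_pow (by omega), mul_zero, zero_mul]
    have hz : Tendsto (fun u : ℝ => 2 * (Nat.factorial (m + 1) / c ^ (m + 1)) * u) (𝓝[≥] 0) (𝓝 0) := by
      have : Tendsto (fun u : ℝ => 2 * (Nat.factorial (m + 1) / c ^ (m + 1)) * u) (𝓝 0)
        (𝓝 (2 * (Nat.factorial (m + 1) / c ^ (m + 1)) * 0)) := (continuous_const.mul continuous_id).tendsto 0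
      rw [mul_zero] at this
      exact this.mono_left nhdsWithin_le_nhds
    refine squeeze_zero_norm' ?_ hz
    filter_upwards [Icc_mem_nhdsGE (zero_lt_one : (0 : ℝ) < 1)] with u hu
    rcases hu.1.eq_or_lt with rfl | hu0
    · simp [show m ≠ 0 by omega]
    · refine (II_norm_le hφ m c u hu0).trans ?_
      have h1 : Real.sqrt u ≤ 1 := Real.sqrt_le_one.mpr hu.2
      have h2 := pow_exp_bound (m + 1) c u hc hu0
      have h3 : u⁻¹ ^ m * Real.exp (-(c / u)) = (u⁻¹ ^ (m + 1) * Real.exp (-(c / u))) * u := by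
        rw [pow_succ]; field_simp
      rw [mul_assoc, h3, mul_assoc 2]
      refine mul_le_mul (by linarith) ?_ (by positivity) (by norm_num)
      exact mul_le_mul_of_nonneg_right h2 hu0.le
  · intro u (hu : 0 < u)
    have h1 : HasDerivAt (fun u : ℝ => Real.exp (-(c / u))) (Real.exp (-(c / u)) * (-(c * (-(u ^ 2)⁻¹)))) u := by
      simp only [div_eq_mul_inv]
      exact (((hasDerivAt_inv hu.ne').const_mul c).neg).exp
    have h2 : HasDerivAt (fun u : ℝ => (u⁻¹) ^ m) (m * (u⁻¹) ^ (m - 1) * (-(u ^ 2)⁻¹)) u :=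
      (hasDerivAt_inv hu.ne').pow m
    refine (((hd u hu).mul h2).mul h1).congr_deriv ?_
    obtain ⟨k, rfl⟩ : ∃ k, m = k + 1 := ⟨m - 1, by omega⟩
    simp only [Nat.add_sub_cancel, pow_succ]
    push_cast
    simp
    ring
  · exact (hi.sub (hi1.const_mul _)).add (hi2.const_mul _)
  · have hz : Tendsto (fun u : ℝ => 2 * (Real.sqrt u)⁻¹) atTop (𝓝 0) := by
      have := (tendsto_inv_atTop_zero.comp Real.tendsto_sqrt_atTop).const_mul (2 : ℝ)
      simpa using this
    refine squeeze_zero_norm' ?_ hz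
    filter_upwards [eventually_ge_atTop (1 : ℝ)] with u hu
    have hu0 : 0 < u := by linarith
    refine (II_norm_le hφ m c u hu0).trans ?_
    have h1 : 1 ≤ Real.sqrt u := Real.one_le_sqrt.mpr hu
    have h2 : (u⁻¹) ^ m ≤ (u⁻¹) ^ 1 := pow_le_pow_of_le_one (by positivity) (inv_le_one_of_one_le₀ hu) hm
    have h3 : Real.exp (-(c / u)) ≤ 1 := Real.exp_le_one_iff.mpr (by
        have : 0 < c / u := by positivity
        linarith)
    calc (1 + Real.sqrt u) * u⁻¹ ^ m * Real.exp (-(c / u))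
          ≤ (2 * Real.sqrt u) * u⁻¹ ^ 1 * 1 := by
            apply mul_le_mul _ h3 (by positivity) (by positivity)
            exact mul_le_mul (by linarith) h2 (by positivity) (by positivity)
      _ = 2 * (Real.sqrt u)⁻¹ := by
        have := Real.mul_self_sqrt hu0.le
        field_simp
        nlinarith

lemma int_sq_exp : ∫ u in Ioi (0 : ℝ), (u⁻¹) ^ 2 * Real.exp (-(1 / u)) = 1 := by
  have key := integral_Ioi_of_hasDerivAt_of_tendsto (a := (0 : ℝ)) (m := (1 : ℝ))
    (f := fun u : ℝ => if u = 0 then 0 else Real.exp (-(1 / u)))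
    (f' := fun u => (u⁻¹) ^ 2 * Real.exp (-(1 / u))) ?_ ?_ ?_ ?_
  · rw [key]; simp
  · have hz : Tendsto (fun u : ℝ => (Nat.factorial 1 / 1 ^ 1) * u) (𝓝[≥] 0) (𝓝 0) := by
      have : Tendsto (fun u : ℝ => (Nat.factorial 1 / 1 ^ 1) * u) (𝓝 0)
        (𝓝 (((Nat.factorial 1 : ℝ) / 1 ^ 1) * 0)) := (continuous_const.mul continuous_id).tendsto 0
      rw [mul_zero] at this
      exact this.mono_left nhdsWithin_le_nhds
    rw [ContinuousWithinAt, if_pos rfl]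
    refine squeeze_zero_norm' ?_ hz
    filter_upwards [self_mem_nhdsWithin] with u (hu : 0 ≤ u)
    rcases hu.eq_or_lt with rfl | hu0
    · simp
    · rw [if_neg hu0.ne', Real.norm_eq_abs, Real.abs_exp]
      have h2 := pow_exp_bound 1 1 u one_pos hu0
      have h3 : Real.exp (-(1 / u)) = (u⁻¹ ^ 1 * Real.exp (-(1 / u))) * u := by
        field_simp
      rw [h3]
      exact mul_le_mul_of_nonneg_right h2 hu0.le
  · intro u (hu : 0 < u)
    have h1 : HasDerivAt (fun u : ℝ => Real.exp (-(1 / u))) (Real.exp (-(1 / u)) * (-(1 * (-(u ^ 2)⁻¹)))) u := by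
      simp only [div_eq_mul_inv]
      exact (((hasDerivAt_inv hu.ne').const_mul 1).neg).exp
    refine (h1.congr_of_eventuallyEq ?_).congr_deriv (by rw [inv_pow]; ring)
    filter_upwards [lt_mem_nhds hu] with x hx
    rw [if_neg hx.ne']
  · have := II_integrable (φ := fun _ => 1) ⟨by fun_prop, fun u _ => by
      simp⟩ 2 le_rfl 1 one_pos
    simpa using this
  · have : Tendsto (fun u : ℝ => Real.exp (-(1 / u))) atTop (𝓝 (Real.exp (-0))) := by
      refine (Real.continuous_exp.tendsto _).comp ?_
      simpa using (tendsto_inv_atTop_zero (𝕜 := ℝ)).neg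
    rw [neg_zero, Real.exp_zero] at this
    refine this.congr' ?_
    filter_upwards [eventually_gt_atTop 0] with x hx
    rw [if_neg hx.ne']

lemma II_scale (φ : ℝ → ℝ) (c : ℝ) (hc : 0 < c) :
    c * II φ 2 c = ∫ x in Ioi (0 : ℝ), φ (c * x) * ((x⁻¹) ^ 2 * Real.exp (-(1 / x))) := by
  have h := integral_comp_mul_left_Ioi (fun u => φ u * (u⁻¹) ^ 2 * Real.exp (-(c / u))) 0 hc
  rw [mul_zero] at h
  rw [II, ← mul_right_inj' (inv_ne_zero hc.ne'), ← mul_assoc, inv_mul_cancel₀ hc.ne', one_mul]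
  rw [smul_eq_mul, eq_comm, inv_mul_eq_iff_eq_mul₀ hc.ne'] at h
  rw [h, ← integral_const_mul, ← integral_const_mul]
  refine setIntegral_congr_fun measurableSet_Ioi fun x (hx : 0 < x) => ?_
  have : c / (c * x) = 1 / x := by field_simp
  simp only [this]
  field_simp

lemma II_tendsto {φ : ℝ → ℝ} (hφ : Continuous φ) (hb : ∀ u, 0 ≤ u → |φ u| ≤ 1) :
    Tendsto (fun c => c * II φ 2 c) (𝓝[>] 0) (𝓝 (φ 0)) := by
  have hi : IntegrableOn (fun x : ℝ => (x⁻¹) ^ 2 * Real.exp (-(1 / x))) (Ioi 0) := by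
    have := II_integrable (φ := fun _ => 1) ⟨by fun_prop, fun u _ => by
      simp⟩ 2 le_rfl 1 one_pos
    simpa using this
  have h : Tendsto (fun c : ℝ => ∫ x in Ioi (0 : ℝ), φ (c * x) * ((x⁻¹) ^ 2 * Real.exp (-(1 / x))))
      (𝓝[>] 0) (𝓝 (∫ x in Ioi (0 : ℝ), φ 0 * ((x⁻¹) ^ 2 * Real.exp (-(1 / x))))) := by
    refine tendsto_integral_filter_of_dominated_convergence
      (fun x : ℝ => (x⁻¹) ^ 2 * Real.exp (-(1 / x))) ?_ ?_ hi ?_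
    · refine Eventually.of_forall fun c => ?_
      exact (hφ.comp (continuous_const.mul continuous_id)).aestronglyMeasurable.mul hi.aestronglyMeasurable
    · filter_upwards [self_mem_nhdsWithin] with c (hc : 0 < c)
      refine (ae_restrict_iff' measurableSet_Ioi).mpr (ae_of_all _ fun x (hx : 0 < x) => ?_)
      rw [norm_mul, Real.norm_eq_abs, Real.norm_eq_abs, abs_of_nonneg (by positivity : 0 ≤ (x⁻¹) ^ 2 * Real.exp (-(1 / x)))]
      exact mul_le_of_le_one_left (by positivity) (hb _ (by positivity))
    · refine ae_of_all _ fun x => ?_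
      refine Tendsto.mul_const _ ?_
      have : Tendsto (fun c : ℝ => φ (c * x)) (𝓝 0) (𝓝 (φ (0 * x))) :=
        (hφ.comp (continuous_id.mul continuous_const)).tendsto 0
      rw [zero_mul] at this
      exact this.mono_left nhdsWithin_le_nhds
  rw [integral_const_mul, int_sq_exp, mul_one] at h
  refine h.congr' ?_
  filter_upwards [self_mem_nhdsWithin] with c hc
  exact (II_scale φ c hc).symm

/-- Auxiliary primitive. -/
noncomputable def hh (u : ℝ) : ℝ := -(u * EE 1 u)

lemma adm_EE (m : ℕ) : Adm (EE m) :=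
  ⟨EE_continuous m, fun u hu => (EE_abs_le m u hu.le).trans (by linarith [Real.sqrt_nonneg u])⟩

lemma adm_hh : Adm hh :=
  ⟨(continuous_id.mul (EE_continuous 1)).neg, fun u hu => by
    rw [hh, abs_neg]; linarith [EE_abs_le_sqrt u hu.le]⟩

lemma hh_hasDerivAt (u : ℝ) : HasDerivAt hh (-EE 0 u) u := by
  refine ((hasDerivAt_id u).mul (EE_hasDerivAt 1 u)).neg.congr_deriv ?_
  have := EE_rec 0 u
  simp at this ⊢
  linarith

lemma hh_bound : ∃ B : ℝ, 0 ≤ B ∧ ∀ c, 0 < c → |c * II hh 2 c| ≤ B * Real.sqrt c := by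
  have hi : IntegrableOn (fun x : ℝ => Real.sqrt x * ((x⁻¹) ^ 2 * Real.exp (-(1 / x)))) (Ioi 0) := by
    have := II_integrable (φ := fun u => Real.sqrt u) ⟨by fun_prop, fun u _ => by
      rw [abs_of_nonneg (Real.sqrt_nonneg u)]; linarith⟩ 2 le_rfl 1 one_pos
    simpa [mul_assoc] using this
  refine ⟨∫ x in Ioi (0 : ℝ), Real.sqrt x * ((x⁻¹) ^ 2 * Real.exp (-(1 / x))), ?_, ?_⟩
  · exact setIntegral_nonneg measurableSet_Ioi fun x (hx : 0 < x) => by positivity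
  · intro c hc
    rw [II_scale _ _ hc, mul_comm, ← integral_const_mul, ← Real.norm_eq_abs]
    refine norm_integral_le_of_norm_le (hi.const_mul _) ?_
    refine (ae_restrict_iff' measurableSet_Ioi).mpr (ae_of_all _ fun x (hx : 0 < x) => ?_)
    rw [norm_mul, Real.norm_eq_abs, Real.norm_eq_abs, abs_of_nonneg (by positivity : 0 ≤ (x⁻¹) ^ 2 * Real.exp (-(1 / x))),
      ← mul_assoc (Real.sqrt c), ← Real.sqrt_mul hc.le]
    refine mul_le_mul_of_nonneg_right ?_ (by positivity)
    rw [hh, abs_neg]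
    exact EE_abs_le_sqrt _ (by positivity)

lemma II_rel1 (c : ℝ) (hc : 0 < c) : II hh 2 c = II (EE 0) 2 c - c * II (EE 0) 3 c := by
  have e : ∀ u ∈ Ioi (0 : ℝ), hh u * (u⁻¹) ^ 2 * Real.exp (-(c / u)) =
      -EE 1 u * (u⁻¹) ^ 1 * Real.exp (-(c / u)) := fun u (hu : 0 < u) => by
    rw [hh]; field_simp
  have h := II_parts (φ' := fun u => -EE 1 u) (adm_EE 0) (fun u _ => EE_hasDerivAt 0 u) 1 le_rfl c hc
    ((integrableOn_congr_fun e measurableSet_Ioi).mp (II_integrable adm_hh 2 le_rfl c hc))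
  have e2 : II hh 2 c = II (fun u => -EE 1 u) 1 c := setIntegral_congr_fun measurableSet_Ioi e
  rw [← e2] at h
  norm_num at h
  linarith

lemma II_rel2 (c : ℝ) (hc : 0 < c) : -2 * II hh 3 c + c * II hh 4 c = II (EE 0) 2 c := by
  have e : ∀ u, -EE 0 u * (u⁻¹) ^ 2 * Real.exp (-(c / u)) =
      -(EE 0 u * (u⁻¹) ^ 2 * Real.exp (-(c / u))) := fun u => by ring
  have h := II_parts (φ' := fun u => -EE 0 u) adm_hh (fun u _ => hh_hasDerivAt u) 2 (by norm_num) c hc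
    (by simp only [e]; exact (II_integrable (adm_EE 0) 2 le_rfl c hc).neg)
  have e2 : II (fun u => -EE 0 u) 2 c = - II (EE 0) 2 c := by
    rw [II, II, ← integral_neg]; simp only [e]
  rw [e2] at h
  norm_num at h
  linarith

lemma growth {f f' : ℝ → ℝ} (A α : ℝ) (hα : 0 < α)
    (hd : ∀ x, 0 < x → HasDerivAt f (f' x) x)
    (hb : ∀ x, 0 < x → |f' x| ≤ A * x ^ (α - 1))
    (h0 : Tendsto f (𝓝[>] 0) (𝓝 0)) (x : ℝ) (hx : 0 < x) : |f x| ≤ A / α * x ^ α := by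
  have aux : ∀ {f f' : ℝ → ℝ}, (∀ x, 0 < x → HasDerivAt f (f' x) x) →
      (∀ x, 0 < x → |f' x| ≤ A * x ^ (α - 1)) → Tendsto f (𝓝[>] 0) (𝓝 0) → f x ≤ A / α * x ^ α := by
    intro f f' hd hb h0
    have hD : ∀ y, 0 < y → HasDerivAt (fun y => A / α * y ^ α - f y) (A * y ^ (α - 1) - f' y) y := by
      intro y hy
      refine (((Real.hasDerivAt_rpow_const (p := α) (Or.inl hy.ne')).const_mul (A / α)).sub (hd y hy)).congr_deriv ?_
      field_simp
    have hm : MonotoneOn (fun y => A / α * y ^ α - f y) (Ioi 0) := by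
      apply monotoneOn_of_deriv_nonneg (convex_Ioi 0)
      · exact fun y hy => (hD y hy).continuousAt.continuousWithinAt
      · rw [interior_Ioi]
        exact fun y hy => (hD y hy).differentiableAt.differentiableWithinAt
      · rw [interior_Ioi]
        intro y hy
        rw [(hD y hy).deriv]
        linarith [le_abs_self (f' y), hb y hy]
    have hlim : Tendsto (fun y => A / α * y ^ α - f y) (𝓝[>] 0) (𝓝 0) := by
      have h1 : Tendsto (fun y : ℝ => A / α * y ^ α) (𝓝 0) (𝓝 (A / α * 0 ^ α)) :=
        ((Real.continuousAt_rpow_const 0 α (Or.inr hα.le)).tendsto).const_mul _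
      rw [Real.zero_rpow hα.ne', mul_zero] at h1
      simpa using (h1.mono_left nhdsWithin_le_nhds).sub h0
    have : 0 ≤ A / α * x ^ α - f x := by
      refine le_of_tendsto hlim ?_
      filter_upwards [Ioc_mem_nhdsGT hx] with y hy
      exact hm hy.1 hx hy.2
    linarith
  rw [abs_le]
  constructor
  · have := aux (f := fun x => -f x) (f' := fun x => -f' x) (fun x hx => (hd x hx).neg)
      (fun x hx => by rw [abs_neg]; exact hb x hx) (by simpa using h0.neg)
    linarith
  · exact aux hd hb h0

/-- terms of the series and of its derivatives -/
noncomputable def uu (a : ℝ) (k : ℕ) (c : ℝ) : ℝ :=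
  c ^ (k + 1) * (Real.log c + a - 2 * harmonicNumber k - harmonicNumber (k + 1)) /
    (Nat.factorial k * Nat.factorial k * Nat.factorial (k + 1))

noncomputable def vv (a : ℝ) (k : ℕ) (c : ℝ) : ℝ :=
  c ^ k * (Real.log c + a - 3 * harmonicNumber k) /
    (Nat.factorial k * Nat.factorial k * Nat.factorial k)

noncomputable def ww (a : ℝ) (k : ℕ) (c : ℝ) : ℝ :=
  c ^ (k + 1) * (Real.log c + a - 2 * harmonicNumber (k + 1) - harmonicNumber k) /
    (Nat.factorial (k + 1) * Nat.factorial (k + 1) * Nat.factorial k)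

lemma harmonicNumber_succ (k : ℕ) : harmonicNumber (k + 1) = harmonicNumber k + 1 / (k + 1) := by
  simp [harmonicNumber, Finset.sum_range_succ]

lemma term_deriv (k : ℕ) (b d c : ℝ) (hc : 0 < c) :
    HasDerivAt (fun c : ℝ => c ^ (k + 1) * (Real.log c + b) / d)
      (c ^ k * ((k + 1) * (Real.log c + b) + 1) / d) c := by
  refine ((((hasDerivAt_pow (k + 1) c)).mul ((Real.hasDerivAt_log hc.ne').add_const b)).div_const d).congr_deriv ?_
  simp only [Nat.add_sub_cancel, pow_succ]
  push_cast
  field_simp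

lemma uu_deriv (a : ℝ) (k : ℕ) (c : ℝ) (hc : 0 < c) : HasDerivAt (uu a k) (vv a k c) c := by
  have h := term_deriv k (a - 2 * harmonicNumber k - harmonicNumber (k + 1))
    (Nat.factorial k * Nat.factorial k * Nat.factorial (k + 1)) c hc
  have e : uu a k = (fun c : ℝ => c ^ (k + 1) * (Real.log c + (a - 2 * harmonicNumber k - harmonicNumber (k + 1))) /
    (Nat.factorial k * Nat.factorial k * Nat.factorial (k + 1))) := by
    ext c; rw [uu]; ring_nf
  rw [e]
  refine h.congr_deriv ?_
  rw [vv, Nat.factorial_succ, harmonicNumber_succ]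
  push_cast
  field_simp
  ring

lemma vv_deriv_zero (a : ℝ) (c : ℝ) (hc : 0 < c) : HasDerivAt (vv a 0) (1 / c) c := by
  have e : vv a 0 = (fun c : ℝ => Real.log c + a) := by
    ext c; simp [vv, harmonicNumber]
  rw [e, one_div]
  exact (Real.hasDerivAt_log hc.ne').add_const a

lemma vv_deriv (a : ℝ) (k : ℕ) (c : ℝ) (hc : 0 < c) : HasDerivAt (vv a (k + 1)) (ww a k c / c) c := by
  have h := term_deriv k (a - 3 * harmonicNumber (k + 1))
    (Nat.factorial (k + 1) * Nat.factorial (k + 1) * Nat.factorial (k + 1)) c hc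
  have e : vv a (k + 1) = (fun c : ℝ => c ^ (k + 1) * (Real.log c + (a - 3 * harmonicNumber (k + 1))) /
    (Nat.factorial (k + 1) * Nat.factorial (k + 1) * Nat.factorial (k + 1))) := by
    ext c; rw [vv]; ring_nf
  rw [e]
  refine h.congr_deriv ?_
  rw [ww, Nat.factorial_succ, harmonicNumber_succ, pow_succ]
  push_cast
  field_simp
  ring

lemma ww_deriv (a : ℝ) (k : ℕ) (c : ℝ) (hc : 0 < c) : HasDerivAt (ww a k) (uu a k c / c) c := by
  have h := term_deriv k (a - 2 * harmonicNumber (k + 1) - harmonicNumber k)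
    (Nat.factorial (k + 1) * Nat.factorial (k + 1) * Nat.factorial k) c hc
  have e : ww a k = (fun c : ℝ => c ^ (k + 1) * (Real.log c + (a - 2 * harmonicNumber (k + 1) - harmonicNumber k)) /
    (Nat.factorial (k + 1) * Nat.factorial (k + 1) * Nat.factorial k)) := by
    ext c; rw [ww]; ring_nf
  rw [e]
  refine h.congr_deriv ?_
  rw [uu, Nat.factorial_succ, harmonicNumber_succ, pow_succ]
  push_cast
  field_simp
  ring

lemma term_tendsto (k : ℕ) (b d : ℝ) :
    Tendsto (fun c : ℝ => c ^ (k + 1) * (Real.log c + b) / d) (𝓝[>] 0) (𝓝 0) := by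
  have h1 := tendsto_log_mul_rpow_nhdsGT_zero (r := 1) one_pos
  have hid : Tendsto (fun c : ℝ => c) (𝓝[>] 0) (𝓝 0) := nhdsWithin_le_nhds
  have h2 := (((hid.pow k).mul (h1.add (hid.mul_const b))).div_const d)
  simp only [Real.rpow_one, zero_mul, add_zero, mul_zero, zero_div] at h2
  refine h2.congr fun c => ?_
  ring

lemma uu_tendsto (a : ℝ) (k : ℕ) : Tendsto (uu a k) (𝓝[>] 0) (𝓝 0) := by
  refine (term_tendsto k (a - 2 * harmonicNumber k - harmonicNumber (k + 1))
    (Nat.factorial k * Nat.factorial k * Nat.factorial (k + 1))).congr fun c => ?_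
  rw [uu]; ring_nf

lemma vv_tendsto (a : ℝ) (k : ℕ) : Tendsto (vv a (k + 1)) (𝓝[>] 0) (𝓝 0) := by
  refine (term_tendsto k (a - 3 * harmonicNumber (k + 1))
    (Nat.factorial (k + 1) * Nat.factorial (k + 1) * Nat.factorial (k + 1))).congr fun c => ?_
  rw [vv]; ring_nf

lemma ww_tendsto (a : ℝ) (k : ℕ) : Tendsto (ww a k) (𝓝[>] 0) (𝓝 0) := by
  refine (term_tendsto k (a - 2 * harmonicNumber (k + 1) - harmonicNumber k)
    (Nat.factorial (k + 1) * Nat.factorial (k + 1) * Nat.factorial k)).congr fun c => ?_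
  rw [ww]; ring_nf

lemma ode_hasSum (K K1 Q : ℝ → ℝ) (a B : ℝ) (hB : 0 ≤ B)
    (hK : ∀ c, 0 < c → HasDerivAt K (K1 c) c)
    (hK1 : ∀ c, 0 < c → HasDerivAt K1 (Q c / c) c)
    (hQ : ∀ c, 0 < c → HasDerivAt Q (K c / c) c)
    (hKb : ∀ c, 0 < c → |K c| ≤ B * Real.sqrt c)
    (hQ0 : Tendsto Q (𝓝[>] 0) (𝓝 1))
    (hK0 : Tendsto (fun c => K1 c - (Real.log c + a)) (𝓝[>] 0) (𝓝 0))
    (c : ℝ) (hc : 0 < c) : HasSum (fun k => uu a k c) (K c) := by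
  have hr : ∀ n c, 0 < c → HasDerivAt (fun c => K c - ∑ k ∈ Finset.range n, uu a k c)
      (K1 c - ∑ k ∈ Finset.range n, vv a k c) c := fun n c hc =>
    (hK c hc).sub (HasDerivAt.fun_sum fun k _ => uu_deriv a k c hc)
  have hs : ∀ n c, 0 < c → HasDerivAt (fun c => K1 c - ∑ k ∈ Finset.range (n + 1), vv a k c)
      ((Q c - 1 - ∑ k ∈ Finset.range n, ww a k c) / c) c := fun n c hc => by
    have h1 := (hK1 c hc).sub ((HasDerivAt.fun_sum (u := Finset.range n) fun k _ => vv_deriv a k c hc).add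
      (vv_deriv_zero a c hc))
    have e : (fun c => K1 c - ∑ k ∈ Finset.range (n + 1), vv a k c) =
      fun c => K1 c - (∑ k ∈ Finset.range n, vv a (k + 1) c + vv a 0 c) := by
      ext c; rw [Finset.sum_range_succ']
    rw [e]
    refine h1.congr_deriv ?_
    rw [← Finset.sum_div]; ring
  have hq : ∀ n c, 0 < c → HasDerivAt (fun c => Q c - 1 - ∑ k ∈ Finset.range n, ww a k c)
      ((K c - ∑ k ∈ Finset.range n, uu a k c) / c) c := fun n c hc => by
    refine (((hQ c hc).sub_const 1).sub (HasDerivAt.fun_sum fun k _ => ww_deriv a k c hc)).congr_deriv ?_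
    rw [← Finset.sum_div]; ring
  have hKlim : Tendsto K (𝓝[>] 0) (𝓝 0) := by
    have h1 : Tendsto (fun c : ℝ => B * Real.sqrt c) (𝓝[>] 0) (𝓝 0) := by
      have : Tendsto (fun c : ℝ => B * Real.sqrt c) (𝓝 0) (𝓝 (B * Real.sqrt 0)) :=
        (continuous_const.mul Real.continuous_sqrt).tendsto 0
      rw [Real.sqrt_zero, mul_zero] at this
      exact this.mono_left nhdsWithin_le_nhds
    refine squeeze_zero_norm' ?_ h1
    filter_upwards [self_mem_nhdsWithin] with c hc using hKb c hc
  have hr0 : ∀ n, Tendsto (fun c => K c - ∑ k ∈ Finset.range n, uu a k c) (𝓝[>] 0) (𝓝 0) := fun n => by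
    simpa using hKlim.sub (tendsto_finsetSum (Finset.range n) fun k _ => uu_tendsto a k)
  have hs0 : ∀ n, Tendsto (fun c => K1 c - ∑ k ∈ Finset.range (n + 1), vv a k c) (𝓝[>] 0) (𝓝 0) := fun n => by
    have h := hK0.sub (tendsto_finsetSum (Finset.range n) fun k _ => vv_tendsto a k)
    simp only [Finset.sum_const_zero, sub_zero] at h
    refine h.congr fun c => ?_
    rw [Finset.sum_range_succ']
    simp [vv, harmonicNumber]; ring
  have hq0 : ∀ n, Tendsto (fun c => Q c - 1 - ∑ k ∈ Finset.range n, ww a k c) (𝓝[>] 0) (𝓝 0) := fun n => by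
    simpa using (hQ0.sub_const 1).sub (tendsto_finsetSum (Finset.range n) fun k _ => ww_tendsto a k)
  have main : ∀ n : ℕ, ∀ c, 0 < c → |K c - ∑ k ∈ Finset.range n, uu a k c| ≤
      B * 4 ^ n / Nat.factorial n * c ^ ((n : ℝ) + 1 / 2) := by
    intro n
    induction n with
    | zero =>
      intro c hc
      have := hKb c hc
      rw [Real.sqrt_eq_rpow] at this
      simpa using this
    | succ n ih =>
      set C := B * 4 ^ n / Nat.factorial n with hC
      have hC0 : 0 ≤ C := by positivity
      set α : ℝ := (n : ℝ) + 1 / 2 with hα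
      have hαp : 0 < α := by positivity
      have b1 : ∀ x, 0 < x → |Q x - 1 - ∑ k ∈ Finset.range n, ww a k x| ≤ C / α * x ^ α := by
        refine growth C α hαp (hq n) (fun x hx => ?_) (hq0 n)
        rw [abs_div, abs_of_pos hx, div_le_iff₀ hx, mul_assoc, ← Real.rpow_add_one hx.ne']
        simpa using ih x hx
      have b2 : ∀ x, 0 < x → |K1 x - ∑ k ∈ Finset.range (n + 1), vv a k x| ≤ C / α / α * x ^ α := by
        refine growth (C / α) α hαp (hs n) (fun x hx => ?_) (hs0 n)
        rw [abs_div, abs_of_pos hx, div_le_iff₀ hx, mul_assoc, ← Real.rpow_add_one hx.ne']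
        simpa using b1 x hx
      have b3 : ∀ x, 0 < x → |K x - ∑ k ∈ Finset.range (n + 1), uu a k x| ≤
          C / α / α / (α + 1) * x ^ (α + 1) := by
        refine growth (C / α / α) (α + 1) (by positivity) (hr (n + 1)) (fun x hx => ?_) (hr0 (n + 1))
        simpa using b2 x hx
      intro c hc
      refine (b3 c hc).trans ?_
      have e : ((n + 1 : ℕ) : ℝ) + 1 / 2 = α + 1 := by push_cast; rw [hα]; ring
      rw [e]
      refine mul_le_mul_of_nonneg_right ?_ (by positivity)
      have e2 : B * 4 ^ (n + 1) / Nat.factorial (n + 1) = C * (4 / (n + 1)) := by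
        rw [hC, Nat.factorial_succ, pow_succ]; push_cast; field_simp
      rw [e2, div_div, div_div, div_eq_mul_inv]
      refine mul_le_mul_of_nonneg_left ?_ hC0
      rw [inv_le_comm₀ (by positivity) (by positivity), inv_div, hα]
      have hn : (0 : ℝ) ≤ n := by positivity
      nlinarith [mul_nonneg hn hn, mul_nonneg hn (mul_nonneg hn hn)]
  have main2 : ∀ n : ℕ, |K c - ∑ k ∈ Finset.range n, uu a k c| ≤
      (B * Real.sqrt c) * ((4 * c) ^ n / Nat.factorial n) := by
    intro n
    refine (main n c hc).trans (le_of_eq ?_)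
    rw [Real.rpow_add hc, Real.rpow_natCast, ← Real.sqrt_eq_rpow, mul_pow]
    ring
  have hsumm := (Real.summable_pow_div_factorial (4 * c)).mul_left (B * Real.sqrt c)
  have hS : Summable (fun k => uu a k c) := by
    refine Summable.of_norm_bounded (hsumm.add ((summable_nat_add_iff 1).mpr hsumm)) fun n => ?_
    have h1 := main2 n
    have h2 := main2 (n + 1)
    have e : uu a n c = (K c - ∑ k ∈ Finset.range n, uu a k c) - (K c - ∑ k ∈ Finset.range (n + 1), uu a k c) := by
      rw [Finset.sum_range_succ]; ring
    rw [e]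
    exact (norm_sub_le _ _).trans (add_le_add h1 h2)
  rw [hS.hasSum_iff_tendsto_nat]
  have h0 := squeeze_zero_norm (fun n => (Real.norm_eq_abs _).trans_le (main2 n)) hsumm.tendsto_atTop_zero
  simpa using (tendsto_const_nhds (x := K c)).sub h0

lemma ftc_Ioi {f f' : ℝ → ℝ} {l m : ℝ} (hd : ∀ x, 0 < x → HasDerivAt f (f' x) x)
    (hi : IntegrableOn f' (Ioi 0)) (h0 : Tendsto f (𝓝[>] 0) (𝓝 l)) (h1 : Tendsto f atTop (𝓝 m)) :
    ∫ x in Ioi (0 : ℝ), f' x = m - l := by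
  have key := integral_Ioi_of_hasDerivAt_of_tendsto (a := (0 : ℝ)) (m := m)
    (f := Function.update f 0 l) (f' := f') ?_ ?_ hi ?_
  · simpa using key
  · rw [← Ici_sdiff_left] at h0
    exact continuousWithinAt_update_same.mpr h0
  · intro x (hx : 0 < x)
    refine (hd x hx).congr_of_eventuallyEq ?_
    filter_upwards [eventually_ne_nhds hx.ne'] with y hy
    exact Function.update_of_ne hy l f
  · refine h1.congr' ?_
    filter_upwards [eventually_ne_atTop 0] with x hx
    exact (Function.update_of_ne hx l f).symm

lemma log_exp_int : IntegrableOn (fun t : ℝ => Real.log t * Real.exp (-t)) (Ioi 0) := by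
  rw [← Ioc_union_Ioi_eq_Ioi (zero_le_one : (0 : ℝ) ≤ 1)]
  apply IntegrableOn.union
  · rw [← intervalIntegrable_iff_integrableOn_Ioc_of_le zero_le_one]
    exact intervalIntegral.intervalIntegrable_log'.mul_continuousOn (by fun_prop)
  · have hi : IntegrableOn (fun t : ℝ => Real.exp (-t) * t ^ ((2 : ℝ) - 1)) (Ioi 1) :=
      (Real.GammaIntegral_convergent two_pos).mono_set (Ioi_subset_Ioi zero_le_one)
    refine Integrable.mono' hi ?_ ?_
    · exact (Real.measurable_log.mul (by fun_prop)).aestronglyMeasurable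
    · refine (ae_restrict_iff' measurableSet_Ioi).mpr (ae_of_all _ fun t (ht : 1 < t) => ?_)
      rw [norm_mul, Real.norm_eq_abs, Real.norm_eq_abs, Real.abs_exp, abs_of_nonneg (Real.log_nonneg ht.le), mul_comm]
      refine mul_le_mul_of_nonneg_left ?_ (Real.exp_pos _).le
      norm_num
      linarith [Real.log_le_sub_one_of_pos (by linarith : 0 < t)]

lemma log_exp_integral :
    ∫ t in Ioi (0 : ℝ), Real.log t * Real.exp (-t) = -Real.eulerMascheroniConstant := by
  have h1 := Complex.hasDerivAt_GammaIntegral (s := 1) (by simp)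
  have h2 : HasDerivAt Complex.GammaIntegral (-(Real.eulerMascheroniConstant : ℂ)) 1 := by
    refine Complex.hasDerivAt_Gamma_one.congr_of_eventuallyEq ?_
    have : {s : ℂ | 0 < s.re} ∈ 𝓝 (1 : ℂ) :=
      (isOpen_lt continuous_const Complex.continuous_re).mem_nhds (by simp)
    filter_upwards [this] with s hs
    exact (Complex.Gamma_eq_integral hs).symm
  have h3 := h1.unique h2
  simp only [sub_self, Complex.cpow_zero, one_mul, ← Complex.ofReal_mul] at h3
  rw [integral_complex_ofReal] at h3
  exact_mod_cast h3

/-- Exponential integral. -/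
noncomputable def E1 (x : ℝ) : ℝ :=
  -(Real.exp (-x) * Real.log x) - Real.eulerMascheroniConstant -
    ∫ t in (0 : ℝ)..x, Real.log t * Real.exp (-t)

lemma log_exp_ii (a b : ℝ) : IntervalIntegrable (fun t : ℝ => Real.log t * Real.exp (-t)) volume a b :=
  intervalIntegral.intervalIntegrable_log'.mul_continuousOn (by fun_prop)

lemma E1_deriv (x : ℝ) (hx : 0 < x) : HasDerivAt E1 (-(Real.exp (-x) / x)) x := by
  have hc : ContinuousAt (fun t : ℝ => Real.log t * Real.exp (-t)) x :=
    (Real.continuousAt_log hx.ne').mul (by fun_prop)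
  have h1 := intervalIntegral.integral_hasDerivAt_right (log_exp_ii 0 x)
    ((Real.measurable_log.mul (by fun_prop)).stronglyMeasurable.stronglyMeasurableAtFilter) hc
  have h2 : HasDerivAt (fun x : ℝ => Real.exp (-x)) (Real.exp (-x) * (-1)) x := (hasDerivAt_neg x).exp
  refine ((((h2.mul (Real.hasDerivAt_log hx.ne')).neg).sub_const _).sub h1).congr_deriv ?_
  field_simp
  ring

lemma E1_top : Tendsto E1 atTop (𝓝 0) := by
  have h1 := intervalIntegral_tendsto_integral_Ioi 0 log_exp_int tendsto_id
  rw [log_exp_integral] at h1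
  have h2 : Tendsto (fun x : ℝ => Real.exp (-x) * Real.log x) atTop (𝓝 0) := by
    have h3 := Real.tendsto_pow_mul_exp_neg_atTop_nhds_zero 1
    refine squeeze_zero_norm' ?_ h3
    filter_upwards [eventually_ge_atTop 1] with x hx
    rw [norm_mul, Real.norm_eq_abs, Real.norm_eq_abs, Real.abs_exp, abs_of_nonneg (Real.log_nonneg hx), mul_comm, pow_one]
    refine mul_le_mul_of_nonneg_right ?_ (Real.exp_pos _).le
    linarith [Real.log_le_sub_one_of_pos (by linarith : 0 < x)]
  have := (h2.neg.sub_const Real.eulerMascheroniConstant).sub h1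
  have e : (-0 - Real.eulerMascheroniConstant - -Real.eulerMascheroniConstant) = 0 := by ring
  rw [e] at this
  exact this

lemma E1_zero : Tendsto (fun x => E1 x + Real.log x) (𝓝[>] 0) (𝓝 (-Real.eulerMascheroniConstant)) := by
  have h1 : Tendsto (fun x : ℝ => ∫ t in (0 : ℝ)..x, Real.log t * Real.exp (-t)) (𝓝[>] 0) (𝓝 0) := by
    have : Continuous (fun x : ℝ => ∫ t in (0 : ℝ)..x, Real.log t * Real.exp (-t)) :=
      intervalIntegral.continuous_primitive log_exp_ii 0
    have := this.tendsto 0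
    rw [intervalIntegral.integral_same] at this
    exact this.mono_left nhdsWithin_le_nhds
  have h2 : Tendsto (fun x : ℝ => (1 - Real.exp (-x)) * Real.log x) (𝓝[>] 0) (𝓝 0) := by
    have h3 := (tendsto_log_mul_rpow_nhdsGT_zero (r := 1) one_pos).norm
    rw [norm_zero] at h3
    refine squeeze_zero_norm' ?_ h3
    filter_upwards [self_mem_nhdsWithin] with x (hx : 0 < x)
    rw [Real.rpow_one, norm_mul, norm_mul, mul_comm]
    refine mul_le_mul_of_nonneg_left ?_ (norm_nonneg _)
    have ha : Real.exp (-x) ≤ 1 := Real.exp_le_one_iff.mpr (by linarith)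
    rw [Real.norm_eq_abs, Real.norm_eq_abs, abs_of_pos hx, abs_of_nonneg (by linarith)]
    linarith [Real.one_sub_le_exp_neg x]
  have := (h2.sub_const Real.eulerMascheroniConstant).sub h1
  simp only [zero_sub, sub_zero] at this
  refine this.congr fun x => ?_
  rw [E1]; ring

lemma E1_laplace (c : ℝ) (hc : 0 < c) :
    IntegrableOn (fun u : ℝ => u⁻¹ * Real.exp (-(c / u))) (Ioc 0 1) ∧
    ∫ u in Ioc (0 : ℝ) 1, u⁻¹ * Real.exp (-(c / u)) = E1 c := by
  have hi : IntegrableOn (fun u : ℝ => u⁻¹ * Real.exp (-(c / u))) (Ioc 0 1) := by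
    have h : IntegrableOn (fun _ : ℝ => (Nat.factorial 1 / c ^ 1 : ℝ)) (Ioc 0 1) :=
      integrableOn_const (by simp)
    refine Integrable.mono' h ?_ ?_
    · have := contOn_aux (fun _ => 1) (by fun_prop) 1 c
      simp only [one_mul, pow_one] at this
      exact (this.mono Ioc_subset_Ioi_self).aestronglyMeasurable measurableSet_Ioc
    · refine (ae_restrict_iff' measurableSet_Ioc).mpr (ae_of_all _ fun u hu => ?_)
      have hu0 : 0 < u := hu.1
      rw [Real.norm_eq_abs, abs_of_nonneg (by positivity)]
      simpa using pow_exp_bound 1 c u hc hu0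
  refine ⟨hi, ?_⟩
  rw [← intervalIntegral.integral_of_le zero_le_one]
  have hd : ∀ u : ℝ, 0 < u → HasDerivAt (fun u => E1 (c / u)) (u⁻¹ * Real.exp (-(c / u))) u := by
    intro u hu
    have h1 : HasDerivAt (fun u : ℝ => c / u) (c * (-(u ^ 2)⁻¹)) u := by
      simp only [div_eq_mul_inv]
      exact (hasDerivAt_inv hu.ne').const_mul c
    refine ((E1_deriv (c / u) (by positivity)).comp u h1).congr_deriv ?_
    field_simp
  have hdiv : Tendsto (fun u : ℝ => c / u) (𝓝[>] 0) atTop := by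
    simp only [div_eq_mul_inv]
    exact tendsto_inv_nhdsGT_zero.const_mul_atTop hc
  have key := intervalIntegral.integral_eq_sub_of_hasDerivAt_of_tendsto (f := fun u => E1 (c / u))
    (zero_lt_one : (0 : ℝ) < 1) (fun u hu => hd u hu.1)
    ((intervalIntegrable_iff_integrableOn_Ioc_of_le zero_le_one).mpr hi)
    (E1_top.comp hdiv) ((hd 1 one_pos).continuousAt.tendsto.mono_left nhdsWithin_le_nhds)
  rw [key]; simp

/-- Regularised kernel. -/
noncomputable def psi (u : ℝ) : ℝ := (if u ≤ 1 then 1 else 0) - EE 1 u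

lemma psi_meas : Measurable psi :=
  (Measurable.ite measurableSet_Iic measurable_const measurable_const).sub (EE_continuous 1).measurable

lemma psi_int : IntegrableOn (fun u => psi u * u⁻¹) (Ioi 0) := by
  have hm : ∀ s : Set ℝ, AEStronglyMeasurable (fun u => psi u * u⁻¹) (volume.restrict s) := fun s =>
    (psi_meas.mul measurable_inv).aestronglyMeasurable
  rw [← Ioc_union_Ioi_eq_Ioi (zero_le_one : (0 : ℝ) ≤ 1)]
  apply IntegrableOn.union
  · have h : IntegrableOn (fun _ : ℝ => (1 : ℝ)) (Ioc 0 1) := integrableOn_const (by simp)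
    refine Integrable.mono' h (hm _) ?_
    refine (ae_restrict_iff' measurableSet_Ioc).mpr (ae_of_all _ fun u hu => ?_)
    have hu0 : 0 < u := hu.1
    rw [psi, if_pos hu.2, norm_mul, norm_inv, Real.norm_eq_abs, Real.norm_eq_abs, abs_of_pos hu0,
      ← div_eq_mul_inv, div_le_one hu0]
    exact EE_one_sub u hu0.le
  · have hi : IntegrableOn (fun u : ℝ => u ^ (-(3 / 2) : ℝ)) (Ioi 1) :=
      (integrableOn_Ioi_rpow_of_lt (by norm_num) one_pos)
    refine Integrable.mono' hi (hm _) ?_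
    refine (ae_restrict_iff' measurableSet_Ioi).mpr (ae_of_all _ fun u (hu : 1 < u) => ?_)
    have hu0 : 0 < u := by linarith
    have h4 : u ^ (-(3 / 2) : ℝ) = Real.sqrt u * (u⁻¹) ^ 2 := by
      rw [Real.sqrt_eq_rpow, ← Real.rpow_natCast (u⁻¹) 2, Real.inv_rpow hu0.le, ← Real.rpow_neg hu0.le,
        ← Real.rpow_add hu0]
      norm_num
    have h5 : psi u * u⁻¹ = -(u * EE 1 u) * u⁻¹ ^ 2 := by
      rw [psi, if_neg (by linarith)]; field_simp; ring
    rw [h4, h5, norm_mul, norm_neg, Real.norm_eq_abs, Real.norm_eq_abs, abs_of_nonneg (by positivity : 0 ≤ u⁻¹ ^ 2)]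
    exact mul_le_mul_of_nonneg_right (EE_abs_le_sqrt u hu0.le) (by positivity)

lemma hh_split (c : ℝ) (hc : 0 < c) :
    II hh 2 c = (∫ u in Ioi (0 : ℝ), psi u * u⁻¹ * Real.exp (-(c / u))) - E1 c := by
  obtain ⟨hi, he⟩ := E1_laplace c hc
  rw [← he]
  have h1 : ∫ u in Ioc (0 : ℝ) 1, u⁻¹ * Real.exp (-(c / u)) =
      ∫ u in Ioi (0 : ℝ), (Iic (1 : ℝ)).indicator (fun u => u⁻¹ * Real.exp (-(c / u))) u := by
    rw [setIntegral_indicator measurableSet_Iic, Ioi_inter_Iic]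
  have hi2 : IntegrableOn ((Iic (1 : ℝ)).indicator (fun u => u⁻¹ * Real.exp (-(c / u)))) (Ioi 0) := by
    rw [IntegrableOn, integrable_indicator_iff measurableSet_Iic, IntegrableOn, Measure.restrict_restrict measurableSet_Iic,
      inter_comm, Ioi_inter_Iic]
    exact hi
  have e : ∀ u ∈ Ioi (0 : ℝ), hh u * (u⁻¹) ^ 2 * Real.exp (-(c / u)) +
      (Iic (1 : ℝ)).indicator (fun u => u⁻¹ * Real.exp (-(c / u))) u =
      psi u * u⁻¹ * Real.exp (-(c / u)) := fun u (hu : 0 < u) => by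
    rw [hh, psi]
    by_cases h : u ≤ 1
    · rw [indicator_of_mem (by exact h), if_pos h]; field_simp; ring
    · rw [indicator_of_notMem (by exact h), if_neg h]; field_simp; ring
  rw [h1, ← setIntegral_congr_fun measurableSet_Ioi e,
    integral_add (II_integrable adm_hh 2 le_rfl c hc) hi2, II]
  ring

lemma laplace_EE1 (p : ℝ) (hp : 0 < p) :
    IntegrableOn (fun u => EE 1 u * Real.exp (-(p * u))) (Ioi 0) ∧
    ∫ u in Ioi (0 : ℝ), EE 1 u * Real.exp (-(p * u)) = 1 - Real.exp (-(1 / p)) := by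
  have hie : IntegrableOn (fun u : ℝ => Real.exp (-(p * u))) (Ioi 0) := by
    have := integrableOn_exp_mul_Ioi (a := -p) (by linarith) 0
    simpa using this
  have hi : IntegrableOn (fun u => EE 1 u * Real.exp (-(p * u))) (Ioi 0) := by
    refine Integrable.mono' hie ((EE_continuous 1).mul (by fun_prop)).aestronglyMeasurable ?_
    refine (ae_restrict_iff' measurableSet_Ioi).mpr (ae_of_all _ fun u (hu : 0 < u) => ?_)
    rw [norm_mul, Real.norm_eq_abs, Real.norm_eq_abs, Real.abs_exp]
    exact mul_le_of_le_one_left (Real.exp_pos _).le (EE_abs_le 1 u hu.le)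
  refine ⟨hi, ?_⟩
  have hg : ∀ k : ℕ, ∫ u in Ioi (0 : ℝ), u ^ k * Real.exp (-(p * u)) = Nat.factorial k / p ^ (k + 1) := by
    intro k
    have := Real.integral_rpow_mul_exp_neg_mul_Ioi (a := (k : ℝ) + 1) (r := p) (by positivity) hp
    simp only [add_sub_cancel_right, Real.rpow_natCast] at this
    rw [this, Real.Gamma_nat_eq_factorial, show ((k : ℝ) + 1) = ((k + 1 : ℕ) : ℝ) by push_cast; rfl, Real.rpow_natCast]
    rw [one_div, inv_pow]; field_simp
  have hgi : ∀ k : ℕ, IntegrableOn (fun u : ℝ => u ^ k * Real.exp (-(p * u))) (Ioi 0) := by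
    intro k
    by_contra hcon
    have h0 := integral_undef hcon
    rw [hg k] at h0
    have : (0 : ℝ) < Nat.factorial k / p ^ (k + 1) := by positivity
    linarith
  have hFeq : ∀ (k : ℕ) (u : ℝ), (-u) ^ k / ((Nat.factorial k : ℝ) * Nat.factorial (k + 1)) * Real.exp (-(p * u)) =
      ((-1) ^ k / ((Nat.factorial k : ℝ) * Nat.factorial (k + 1))) * (u ^ k * Real.exp (-(p * u))) := by
    intro k u; rw [neg_pow]; ring
  have hFi : ∀ k : ℕ, IntegrableOn (fun u : ℝ => (-u) ^ k / ((Nat.factorial k : ℝ) * Nat.factorial (k + 1)) * Real.exp (-(p * u))) (Ioi 0) := by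
    intro k
    simp only [hFeq]
    exact (hgi k).const_mul _
  have hnorm : ∀ k : ℕ, ∫ u in Ioi (0 : ℝ), ‖(-u) ^ k / ((Nat.factorial k : ℝ) * Nat.factorial (k + 1)) * Real.exp (-(p * u))‖ =
      (1 / p) ^ (k + 1) / Nat.factorial (k + 1) := by
    intro k
    have : ∀ u ∈ Ioi (0 : ℝ), ‖(-u) ^ k / ((Nat.factorial k : ℝ) * Nat.factorial (k + 1)) * Real.exp (-(p * u))‖ =
      (1 / ((Nat.factorial k : ℝ) * Nat.factorial (k + 1))) * (u ^ k * Real.exp (-(p * u))) := by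
      intro u (hu : 0 < u)
      rw [norm_mul, norm_div, norm_pow, norm_neg, Real.norm_eq_abs, Real.norm_eq_abs, Real.norm_eq_abs, Real.abs_exp,
        abs_of_pos hu, abs_of_nonneg (by positivity : (0 : ℝ) ≤ (Nat.factorial k : ℝ) * Nat.factorial (k + 1))]
      ring
    rw [setIntegral_congr_fun measurableSet_Ioi this, integral_const_mul, hg, one_div p, inv_pow]
    field_simp
  have hS := hasSum_integral_of_summable_integral_norm hFi (by
    simp only [hnorm]
    exact (summable_nat_add_iff 1).mpr (Real.summable_pow_div_factorial (1 / p)))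
  have hval : ∀ k : ℕ, ∫ u in Ioi (0 : ℝ), (-u) ^ k / ((Nat.factorial k : ℝ) * Nat.factorial (k + 1)) * Real.exp (-(p * u)) =
      -((-(1 / p)) ^ (k + 1) / Nat.factorial (k + 1)) := by
    intro k
    simp only [hFeq]
    rw [integral_const_mul, hg, neg_pow (1 / p), one_div p, inv_pow, pow_succ (-1 : ℝ)]
    field_simp
  simp only [hval, tsum_mul_right] at hS
  have hE : HasSum (fun n : ℕ => (-(1 / p)) ^ n / Nat.factorial n) (Real.exp (-(1 / p))) := by
    rw [Real.exp_eq_exp_ℝ]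
    exact NormedSpace.expSeries_div_hasSum_exp _
  rw [← hasSum_nat_add_iff' 1] at hE
  have := hS.unique hE.neg
  simp only [Finset.range_one, Finset.sum_singleton, pow_zero, Nat.factorial_zero, Nat.cast_one, div_one] at this
  simp only [EE]
  rw [this]; ring

lemma psi_laplace (p : ℝ) (hp : 0 < p) :
    ∫ u in Ioi (0 : ℝ), psi u * Real.exp (-(p * u)) = (1 - Real.exp (-p)) / p + (Real.exp (-(1 / p)) - 1) := by
  obtain ⟨hi, he⟩ := laplace_EE1 p hp
  have hie : IntegrableOn (fun u : ℝ => Real.exp (-(p * u))) (Ioi 0) := by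
    have := integrableOn_exp_mul_Ioi (a := -p) (by linarith) 0
    simpa using this
  have hii : IntegrableOn ((Iic (1 : ℝ)).indicator (fun u => Real.exp (-(p * u)))) (Ioi 0) :=
    hie.indicator measurableSet_Iic
  have e : ∀ u, psi u * Real.exp (-(p * u)) = (Iic (1 : ℝ)).indicator (fun u => Real.exp (-(p * u))) u -
      EE 1 u * Real.exp (-(p * u)) := by
    intro u
    rw [psi]
    by_cases h : u ≤ 1
    · rw [indicator_of_mem (by exact h), if_pos h]; ring
    · rw [indicator_of_notMem (by exact h), if_neg h]; ring
  simp only [e]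
  rw [integral_sub hii hi, he, setIntegral_indicator measurableSet_Iic, Ioi_inter_Iic,
    ← intervalIntegral.integral_of_le zero_le_one]
  have hd : ∀ u ∈ uIcc (0 : ℝ) 1, HasDerivAt (fun u => -(Real.exp (-(p * u)) / p)) (Real.exp (-(p * u))) u := by
    intro u _
    have : HasDerivAt (fun u : ℝ => Real.exp (-(p * u))) (Real.exp (-(p * u)) * (-(p * 1))) u :=
      (((hasDerivAt_id u).const_mul p).neg).exp
    refine ((this.div_const p).neg).congr_deriv ?_
    field_simp
  rw [intervalIntegral.integral_eq_sub_of_hasDerivAt hd ((by fun_prop : Continuous fun u : ℝ => Real.exp (-(p * u))).intervalIntegrable _ _)]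
  simp
  ring

lemma psi_prod : Integrable (Function.uncurry fun u p : ℝ => psi u * Real.exp (-(p * u)))
    ((volume.restrict (Ioi 0)).prod (volume.restrict (Ioi 0))) := by
  have hm : Measurable (Function.uncurry fun u p : ℝ => psi u * Real.exp (-(p * u))) := by
    refine (psi_meas.comp measurable_fst).mul ?_
    exact (by fun_prop : Continuous fun x : ℝ × ℝ => Real.exp (-(x.2 * x.1))).measurable
  have hie : ∀ u : ℝ, 0 < u → IntegrableOn (fun p : ℝ => Real.exp (-(p * u))) (Ioi 0) := fun u hu => by
    have := integrableOn_exp_mul_Ioi (a := -u) (by linarith) 0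
    simpa [mul_comm] using this
  rw [integrable_prod_iff hm.aestronglyMeasurable]
  constructor
  · refine (ae_restrict_iff' measurableSet_Ioi).mpr (ae_of_all _ fun u (hu : 0 < u) => ?_)
    exact (hie u hu).const_mul (psi u)
  · refine (integrableOn_congr_fun ?_ measurableSet_Ioi).mpr psi_int.norm
    intro u (hu : 0 < u)
    simp only [Function.uncurry, norm_mul, Real.norm_eq_abs, Real.abs_exp]
    rw [integral_const_mul]
    have := integral_exp_mul_Ioi (a := -u) (by linarith) 0
    simp only [neg_mul, mul_comm u] at this
    rw [this]
    simp [abs_of_pos hu]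

lemma psi_integral : ∫ u in Ioi (0 : ℝ), psi u * u⁻¹ = 2 * Real.eulerMascheroniConstant - 1 := by
  have h1 : ∫ u in Ioi (0 : ℝ), psi u * u⁻¹ = ∫ u in Ioi (0 : ℝ), ∫ p in Ioi (0 : ℝ), psi u * Real.exp (-(p * u)) := by
    refine setIntegral_congr_fun measurableSet_Ioi fun u (hu : 0 < u) => ?_
    rw [integral_const_mul]
    have := integral_exp_mul_Ioi (a := -u) (by linarith) 0
    simp only [neg_mul, mul_comm u] at this
    rw [this]
    simp
  have hi := psi_prod.integral_prod_right
  rw [h1, integral_integral_swap psi_prod, setIntegral_congr_fun measurableSet_Ioi fun p hp => psi_laplace p hp]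
  have hi2 : IntegrableOn (fun p : ℝ => (1 - Real.exp (-p)) / p + (Real.exp (-(1 / p)) - 1)) (Ioi 0) :=
    (integrableOn_congr_fun (fun p hp => psi_laplace p hp) measurableSet_Ioi).mp hi
  have hinv0 : Tendsto (fun p : ℝ => 1 / p) (𝓝[>] 0) atTop := by
    simpa using tendsto_inv_nhdsGT_zero (𝕜 := ℝ)
  have hinv1 : Tendsto (fun p : ℝ => 1 / p) atTop (𝓝[>] 0) := by
    simpa using tendsto_inv_atTop_nhdsGT_zero (𝕜 := ℝ)
  have key := ftc_Ioi (f := fun p => p * (Real.exp (-(1 / p)) - 1) - E1 (1 / p) + (E1 p + Real.log p))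
    (l := 0 - 0 + (-Real.eulerMascheroniConstant)) (m := Real.eulerMascheroniConstant - 1) ?_ hi2 ?_ ?_
  · rw [key]; ring
  · intro p hp
    have h1 : HasDerivAt (fun u : ℝ => 1 / u) (-(p ^ 2)⁻¹) p := by
      simpa using (hasDerivAt_inv hp.ne')
    have h2 := ((hasDerivAt_id p).mul ((h1.neg.exp).sub_const 1)).sub
      ((E1_deriv (1 / p) (by positivity)).comp p h1) |>.add ((E1_deriv p hp).add (Real.hasDerivAt_log hp.ne'))
    refine h2.congr_deriv ?_
    simp
    field_simp
    ring
  · refine (Tendsto.sub ?_ (E1_top.comp hinv0)).add E1_zero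
    have hid : Tendsto (fun c : ℝ => |c|) (𝓝[>] 0) (𝓝 0) := by
      have : Tendsto (fun c : ℝ => |c|) (𝓝 0) (𝓝 |0|) := continuous_abs.tendsto 0
      rw [abs_zero] at this
      exact this.mono_left nhdsWithin_le_nhds
    refine squeeze_zero_norm' ?_ hid
    filter_upwards [self_mem_nhdsWithin] with p (hp : 0 < p)
    rw [norm_mul, Real.norm_eq_abs]
    refine mul_le_of_le_one_right (abs_nonneg _) ?_
    have : Real.exp (-(1 / p)) ≤ 1 := Real.exp_le_one_iff.mpr (by
      have : 0 < 1 / p := by positivity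
      linarith)
    rw [Real.norm_eq_abs, abs_le]
    constructor <;> linarith [Real.exp_pos (-(1 / p))]
  · have hA : Tendsto (fun p : ℝ => p * (Real.exp (-(1 / p)) - 1)) atTop (𝓝 (-1)) := by
      have hd : HasDerivAt (fun x : ℝ => Real.exp (-x)) (-1) 0 := by
        simpa using (hasDerivAt_neg (0 : ℝ)).exp
      rw [hasDerivAt_iff_tendsto_slope] at hd
      have := (hd.mono_left (nhdsWithin_mono 0 (fun x (hx : 0 < x) => hx.ne'))).comp hinv1
      refine this.congr fun p => ?_
      simp [slope_def_field]
      ring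
    have hB := E1_zero.comp hinv1
    have := (hA.sub hB).add E1_top
    refine (this.congr fun p => ?_).trans (by simp; ring_nf)
    simp
    ring

lemma hh_asymp : Tendsto (fun c => II hh 2 c - (Real.log c + (3 * Real.eulerMascheroniConstant - 1)))
    (𝓝[>] 0) (𝓝 0) := by
  have h1 : Tendsto (fun c : ℝ => ∫ u in Ioi (0 : ℝ), psi u * u⁻¹ * Real.exp (-(c / u))) (𝓝[>] 0)
      (𝓝 (∫ u in Ioi (0 : ℝ), psi u * u⁻¹)) := by
    refine tendsto_integral_filter_of_dominated_convergence (fun u => ‖psi u * u⁻¹‖) ?_ ?_ psi_int.norm ?_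
    · refine Eventually.of_forall fun c => ?_
      exact ((psi_meas.mul measurable_inv).mul (by fun_prop)).aestronglyMeasurable
    · filter_upwards [self_mem_nhdsWithin] with c (hc : 0 < c)
      refine (ae_restrict_iff' measurableSet_Ioi).mpr (ae_of_all _ fun u (hu : 0 < u) => ?_)
      rw [norm_mul]
      refine mul_le_of_le_one_right (norm_nonneg _) ?_
      rw [Real.norm_eq_abs, Real.abs_exp]
      exact Real.exp_le_one_iff.mpr (by
        have : 0 < c / u := by positivity
        linarith)
    · refine ae_of_all _ fun u => ?_
      have : Tendsto (fun c : ℝ => psi u * u⁻¹ * Real.exp (-(c / u))) (𝓝 0) (𝓝 (psi u * u⁻¹ * Real.exp (-(0 / u)))) :=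
        (by fun_prop : Continuous fun c : ℝ => psi u * u⁻¹ * Real.exp (-(c / u))).tendsto 0
      simp only [zero_div, neg_zero, Real.exp_zero, mul_one] at this
      exact this.mono_left nhdsWithin_le_nhds
  rw [psi_integral] at h1
  have h2 := (h1.sub E1_zero).sub_const (3 * Real.eulerMascheroniConstant - 1)
  have e : 2 * Real.eulerMascheroniConstant - 1 - -Real.eulerMascheroniConstant - (3 * Real.eulerMascheroniConstant - 1) = 0 := by ring
  rw [e] at h2
  refine h2.congr' ?_
  filter_upwards [self_mem_nhdsWithin] with c hc
  rw [hh_split c hc]; ring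

lemma K_hasSum (c : ℝ) (hc : 0 < c) :
    HasSum (fun k => uu (3 * Real.eulerMascheroniConstant) k c) (c * II hh 2 c) := by
  obtain ⟨B, hB, hKb⟩ := hh_bound
  refine ode_hasSum (fun c => c * II hh 2 c) (fun c => II hh 2 c - c * II hh 3 c)
    (fun c => c * II (EE 0) 2 c) _ B hB ?_ ?_ ?_ hKb ?_ ?_ c hc
  · intro c hc
    refine ((hasDerivAt_id c).mul (II_hasDerivAt adm_hh 2 le_rfl c hc)).congr_deriv ?_
    simp
    ring
  · intro c hc
    refine ((II_hasDerivAt adm_hh 2 le_rfl c hc).sub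
      ((hasDerivAt_id c).mul (II_hasDerivAt adm_hh 3 (by norm_num) c hc))).congr_deriv ?_
    have := II_rel2 c hc
    rw [mul_div_cancel_left₀ _ hc.ne', ← this]
    simp
    ring
  · intro c hc
    refine ((hasDerivAt_id c).mul (II_hasDerivAt (adm_EE 0) 2 le_rfl c hc)).congr_deriv ?_
    have := II_rel1 c hc
    rw [mul_div_cancel_left₀ _ hc.ne', this]
    simp
    ring
  · have := II_tendsto (EE_continuous 0) (EE_abs_le 0)
    simpa [EE_zero] using this
  · have h := II_tendsto (φ := fun u => -EE 1 u) (EE_continuous 1).neg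
      (fun u hu => by rw [abs_neg]; exact EE_abs_le 1 u hu)
    have h2 := hh_asymp.sub h
    have e : (0 : ℝ) - -EE 1 0 = 1 := by simp [EE_zero]
    rw [e] at h2
    have h3 := h2.sub_const 1
    rw [sub_self] at h3
    refine h3.congr fun c => ?_
    have e2 : II hh 3 c = II (fun u => -EE 1 u) 2 c := by
      refine setIntegral_congr_fun measurableSet_Ioi fun u (hu : 0 < u) => ?_
      simp only [hh]
      field_simp
    rw [e2]
    ring

lemma prim_deriv (c u : ℝ) (hc : 0 < c) (hu : 0 < u) :
    HasDerivAt (fun u => -hh u * (Real.exp (-(c / u)) - 1) +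
      c * ∫ v in (0 : ℝ)..u, hh v * (v⁻¹) ^ 2 * Real.exp (-(c / v)))
      (EE 0 u * (Real.exp (-(c / u)) - 1)) u := by
  have hintg := II_integrable adm_hh 2 le_rfl c hc
  have hcont := contOn_aux hh adm_hh.1 2 c
  have h1 := intervalIntegral.integral_hasDerivAt_right (a := 0) (b := u)
    (f := fun v => hh v * (v⁻¹) ^ 2 * Real.exp (-(c / v)))
    ((intervalIntegrable_iff_integrableOn_Ioc_of_le hu.le).mpr (hintg.mono_set Ioc_subset_Ioi_self))
    (hcont.stronglyMeasurableAtFilter isOpen_Ioi u hu) (hcont.continuousAt (Ioi_mem_nhds hu))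
  have h2 : HasDerivAt (fun u : ℝ => Real.exp (-(c / u)) - 1) (Real.exp (-(c / u)) * (c * (u ^ 2)⁻¹)) u := by
    have := (((hasDerivAt_inv hu.ne').const_mul c).neg.exp).sub_const 1
    simpa [div_eq_mul_inv] using this
  refine (((hh_hasDerivAt u).neg.mul h2).add (h1.const_mul c)).congr_deriv ?_
  simp
  ring

lemma exp_fac (c u : ℝ) (hc : 0 < c) (hu : 0 < u) : |Real.exp (-(c / u)) - 1| ≤ min 1 (c / u) := by
  have h0 : 0 < c / u := by positivity
  have h1 : Real.exp (-(c / u)) ≤ 1 := Real.exp_le_one_iff.mpr (by linarith)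
  have h2 := Real.add_one_le_exp (-(c / u))
  have h3 := Real.exp_pos (-(c / u))
  rw [abs_of_nonpos (by linarith)]
  exact le_min (by linarith) (by linarith)

lemma prim_zero (c : ℝ) (hc : 0 < c) :
    Tendsto (fun u => -hh u * (Real.exp (-(c / u)) - 1) +
      c * ∫ v in (0 : ℝ)..u, hh v * (v⁻¹) ^ 2 * Real.exp (-(c / v))) (𝓝[>] 0) (𝓝 0) := by
  have hintg := II_integrable adm_hh 2 le_rfl c hc
  have h1 : Tendsto (fun u : ℝ => -hh u * (Real.exp (-(c / u)) - 1)) (𝓝[>] 0) (𝓝 0) := by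
    have hid : Tendsto (fun u : ℝ => |hh u|) (𝓝[>] 0) (𝓝 0) := by
      have : Tendsto (fun u : ℝ => |hh u|) (𝓝 0) (𝓝 |hh 0|) := adm_hh.1.abs.tendsto 0
      simp only [hh, zero_mul, neg_zero, abs_zero] at this
      exact this.mono_left nhdsWithin_le_nhds
    refine squeeze_zero_norm' ?_ hid
    filter_upwards [self_mem_nhdsWithin] with u (hu : 0 < u)
    rw [norm_mul, norm_neg, Real.norm_eq_abs, Real.norm_eq_abs]
    exact mul_le_of_le_one_right (abs_nonneg _) ((exp_fac c u hc hu).trans (min_le_left _ _))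
  have h2 : Tendsto (fun u : ℝ => ∫ v in (0 : ℝ)..u, hh v * (v⁻¹) ^ 2 * Real.exp (-(c / v))) (𝓝[>] 0) (𝓝 0) := by
    have hii : IntervalIntegrable (fun v => hh v * (v⁻¹) ^ 2 * Real.exp (-(c / v))) volume 0 1 :=
      (intervalIntegrable_iff_integrableOn_Ioc_of_le zero_le_one).mpr (hintg.mono_set Ioc_subset_Ioi_self)
    have := intervalIntegral.continuousOn_primitive_interval' hii left_mem_uIcc
    have := this 0 left_mem_uIcc
    rw [ContinuousWithinAt, intervalIntegral.integral_same, uIcc_of_le zero_le_one] at this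
    have e : 𝓝[>] (0 : ℝ) ≤ 𝓝[Icc 0 1] 0 := by
      rw [← nhdsWithin_Ioc_eq_nhdsGT (zero_lt_one : (0 : ℝ) < 1)]
      exact nhdsWithin_mono _ Ioc_subset_Icc_self
    exact this.mono_left e
  simpa using h1.add (h2.const_mul c)

lemma prim_top (c : ℝ) (hc : 0 < c) :
    Tendsto (fun u => -hh u * (Real.exp (-(c / u)) - 1) +
      c * ∫ v in (0 : ℝ)..u, hh v * (v⁻¹) ^ 2 * Real.exp (-(c / v))) atTop (𝓝 (c * II hh 2 c)) := by
  have hintg := II_integrable adm_hh 2 le_rfl c hc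
  have h1 : Tendsto (fun u : ℝ => -hh u * (Real.exp (-(c / u)) - 1)) atTop (𝓝 0) := by
    have hid : Tendsto (fun u : ℝ => c * (Real.sqrt u)⁻¹) atTop (𝓝 0) := by
      simpa using (tendsto_inv_atTop_zero.comp Real.tendsto_sqrt_atTop).const_mul c
    refine squeeze_zero_norm' ?_ hid
    filter_upwards [eventually_gt_atTop 0] with u hu
    rw [norm_mul, norm_neg, Real.norm_eq_abs, Real.norm_eq_abs]
    have h := EE_abs_le_sqrt u hu.le
    rw [hh, abs_neg]
    refine (mul_le_mul h ((exp_fac c u hc hu).trans (min_le_right _ _)) (abs_nonneg _) (Real.sqrt_nonneg _)).trans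
      (le_of_eq ?_)
    have hq : 0 < Real.sqrt u := Real.sqrt_pos.mpr hu
    have := Real.mul_self_sqrt hu.le
    field_simp
    rw [sq, this]
  have h2 := (intervalIntegral_tendsto_integral_Ioi 0 hintg tendsto_id).const_mul c
  simpa [II] using h1.add h2

lemma radial (ω s R : ℝ) (hω : 0 < ω) (hs : 0 < s) (hR : 0 < R) :
    (∫ ρ in (0 : ℝ)..R, 2 * ρ * besselJ0 (ρ * Real.sqrt (2 * ω)) * (Real.exp (-s / ρ ^ 2) - 1)) =
    (2 / ω) * (-hh (ω * R ^ 2 / 2) * (Real.exp (-((s * ω / 2) / (ω * R ^ 2 / 2))) - 1) +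
      (s * ω / 2) * ∫ v in (0 : ℝ)..(ω * R ^ 2 / 2), hh v * (v⁻¹) ^ 2 * Real.exp (-((s * ω / 2) / v))) := by
  have hc : 0 < s * ω / 2 := by positivity
  have hd : ∀ ρ : ℝ, 0 < ρ → HasDerivAt (fun R : ℝ => (2 / ω) *
      (-hh (ω * R ^ 2 / 2) * (Real.exp (-((s * ω / 2) / (ω * R ^ 2 / 2))) - 1) +
      (s * ω / 2) * ∫ v in (0 : ℝ)..(ω * R ^ 2 / 2), hh v * (v⁻¹) ^ 2 * Real.exp (-((s * ω / 2) / v))))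
      (2 * ρ * besselJ0 (ρ * Real.sqrt (2 * ω)) * (Real.exp (-s / ρ ^ 2) - 1)) ρ := by
    intro ρ hρ
    have h1 : HasDerivAt (fun R : ℝ => ω * R ^ 2 / 2) (ω * ρ) ρ := by
      refine ((((hasDerivAt_id ρ).pow 2).const_mul ω).div_const 2).congr_deriv ?_
      simp
      ring
    have h2 := ((prim_deriv (s * ω / 2) (ω * ρ ^ 2 / 2) hc (by positivity)).comp ρ h1).const_mul (2 / ω)
    refine h2.congr_deriv ?_
    rw [besselJ0_eq ω ρ hω]
    have e : -((s * ω / 2) / (ω * ρ ^ 2 / 2)) = -s / ρ ^ 2 := by field_simp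
    rw [e]
    field_simp
  have hintg : IntervalIntegrable (fun ρ : ℝ => 2 * ρ * besselJ0 (ρ * Real.sqrt (2 * ω)) *
      (Real.exp (-s / ρ ^ 2) - 1)) volume 0 R := by
    rw [intervalIntegrable_iff_integrableOn_Ioc_of_le hR.le]
    simp only [fun ρ => besselJ0_eq ω ρ hω]
    have hE := EE_continuous 0
    have hm : Measurable (fun ρ : ℝ => 2 * ρ * EE 0 (ω * ρ ^ 2 / 2) * (Real.exp (-s / ρ ^ 2) - 1)) := by
      refine ((by fun_prop : Continuous fun ρ : ℝ => 2 * ρ * EE 0 (ω * ρ ^ 2 / 2)).measurable).mul ?_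
      fun_prop
    refine Measure.integrableOn_of_bounded (M := 2 * R) (by simp) hm.aestronglyMeasurable ?_
    refine (ae_restrict_iff' measurableSet_Ioc).mpr (ae_of_all _ fun ρ hρ => ?_)
    obtain ⟨h0, h1⟩ := hρ
    have hE := EE_abs_le 0 (ω * ρ ^ 2 / 2) (by positivity)
    have hx := (exp_fac s (ρ ^ 2) hs (by positivity)).trans (min_le_left _ _)
    rw [← neg_div] at hx
    rw [norm_mul, norm_mul, Real.norm_eq_abs, Real.norm_eq_abs, Real.norm_eq_abs, abs_of_pos (by positivity : 0 < 2 * ρ)]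
    calc 2 * ρ * |EE 0 (ω * ρ ^ 2 / 2)| * |Real.exp (-s / ρ ^ 2) - 1| ≤ 2 * ρ * 1 * 1 := by gcongr
      _ ≤ 2 * R := by linarith
  have key := intervalIntegral.integral_eq_sub_of_hasDerivAt_of_tendsto hR (fun ρ hρ => hd ρ hρ.1) hintg
    (fa := 0) ?_ ((hd R hR).continuousAt.tendsto.mono_left nhdsWithin_le_nhds)
  · rw [key, sub_zero]
  · have ht : Tendsto (fun R : ℝ => ω * R ^ 2 / 2) (𝓝[>] 0) (𝓝[>] 0) := by
      refine tendsto_nhdsWithin_iff.mpr ⟨?_, ?_⟩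
      · have : Tendsto (fun R : ℝ => ω * R ^ 2 / 2) (𝓝 0) (𝓝 (ω * 0 ^ 2 / 2)) :=
          (by fun_prop : Continuous fun R : ℝ => ω * R ^ 2 / 2).tendsto 0
        simp only [ne_eq, OfNat.ofNat_ne_zero, not_false_eq_true, zero_pow, mul_zero, zero_div] at this
        exact this.mono_left nhdsWithin_le_nhds
      · filter_upwards [self_mem_nhdsWithin] with R (hR : 0 < R)
        exact (by positivity : 0 < ω * R ^ 2 / 2)
    have := ((prim_zero (s * ω / 2) hc).comp ht).const_mul (2 / ω)
    rw [mul_zero] at this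
    exact this

lemma main_pos (ω s : ℝ) (hω : 0 < ω) (hs : 0 < s) :
    Tendsto (fun R : ℝ => ∫ ρ in (0 : ℝ)..R,
        2 * ρ * besselJ0 (ρ * Real.sqrt (2 * ω)) * (Real.exp (-s / ρ ^ 2) - 1))
      atTop
      (𝓝 (∑' k : ℕ, s ^ (k + 1) *
        (Real.log s - 2 * harmonicNumber k - harmonicNumber (k + 1) + Real.log ω +
          3 * Real.eulerMascheroniConstant - Real.log 2) /
        (Nat.factorial k * Nat.factorial k * Nat.factorial (k + 1)) *
        (ω / 2) ^ k)) := by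
  have hc : 0 < s * ω / 2 := by positivity
  have hS := ((K_hasSum (s * ω / 2) hc).mul_left (2 / ω)).tsum_eq
  have e : ∀ k : ℕ, s ^ (k + 1) *
        (Real.log s - 2 * harmonicNumber k - harmonicNumber (k + 1) + Real.log ω +
          3 * Real.eulerMascheroniConstant - Real.log 2) /
        (Nat.factorial k * Nat.factorial k * Nat.factorial (k + 1)) *
        (ω / 2) ^ k = 2 / ω * uu (3 * Real.eulerMascheroniConstant) k (s * ω / 2) := by
    intro k
    rw [uu, Real.log_div (by positivity) two_ne_zero, Real.log_mul hs.ne' hω.ne', mul_div_assoc s,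
      mul_pow s, pow_succ (ω / 2)]
    field_simp
    ring
  rw [tsum_congr e, hS]
  have ht : Tendsto (fun R : ℝ => ω * R ^ 2 / 2) atTop atTop :=
    ((tendsto_pow_atTop two_ne_zero).const_mul_atTop hω).atTop_div_const two_pos
  refine (((prim_top (s * ω / 2) hc).comp ht).const_mul (2 / ω)).congr' ?_
  filter_upwards [eventually_gt_atTop 0] with R hR
  exact (radial ω s R hω hs hR).symm

end Helpers

/-- For `ω > 0`, `s ≥ 0`, the improper integral
`2∫_0^∞ ρ J₀(ρ√(2ω)) (e^{-s/ρ²} − 1) dρ` equals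
`∑_{k=1}^∞ s^k [ln s − 2H_{k-1} − H_k + ln ω + 3γ − ln 2] / ((k-1)!² k!) (ω/2)^{k-1}`. -/
theorem improper_integral_besselJ0 (ω s : ℝ) (hω : 0 < ω) (hs : 0 ≤ s) :
    Tendsto (fun R : ℝ => ∫ ρ in (0 : ℝ)..R,
        2 * ρ * besselJ0 (ρ * Real.sqrt (2 * ω)) * (Real.exp (-s / ρ ^ 2) - 1))
      atTop
      (nhds (∑' k : ℕ, s ^ (k + 1) *
        (Real.log s - 2 * harmonicNumber k - harmonicNumber (k + 1) + Real.log ω +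
          3 * Real.eulerMascheroniConstant - Real.log 2) /
        (Nat.factorial k * Nat.factorial k * Nat.factorial (k + 1)) *
        (ω / 2) ^ k)) := by
  rcases hs.eq_or_lt with h | h
  · subst h
    simp
  · exact main_pos ω s hω h
end
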